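/- arXiv:2009.05291 — 2 statements merged into one kernel-verified Lean document; each statement's English description precedes it below -/
import Mathlib

section
/- Let A = ℂ[u,v,x_1,...,x_n]/(uv − f_1^{a_1}···f_t^{a_t}) with f_i irreducible, pairwise coprime, non-constant, and a_i ≥ 1. Then the divisor class group of A satisfies Cl(A) ≅ ℤ^t / ⟨(a_1,...,a_t)⟩, the quotient of the free abelian group of rank t by the subgroup generated by the vector (a_1,...,a_t). -/
universe u v

/-! ### Valuations at primes and the divisor class group -/

/-- The order (valuation) of `a` at the prime `p`: the supremum of the `n` such that `a`
lies in the `n`-th power of the maximal ideal `pR_p` of the localization `R_p`.  For the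
localization at a height one prime of a normal noetherian domain, `R_p` is a discrete
valuation ring and this is the associated valuation `ν_p`. -/
noncomputable def ordAt (R : Type u) [CommRing R] (p : Ideal R) [p.IsPrime] (a : R) : ℕ∞ :=
  ⨆ n ∈ {n : ℕ | algebraMap R (Localization.AtPrime p) a ∈
      Ideal.map (algebraMap R (Localization.AtPrime p)) p ^ n}, (n : ℕ∞)

/-- The set of height one primes of `R`. -/
def heightOnePrimes (R : Type u) [CommRing R] : Set (PrimeSpectrum R) :=
  { p | Order.height p = 1 }

/-- The group `Div R` of Weil divisors: the free abelian group on the height one primes. -/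
abbrev DivisorGroup (R : Type u) [CommRing R] : Type u :=
  ↥(heightOnePrimes R) →₀ ℤ

/-- The set of principal Weil divisors: divisors of the form `div(a/b) = div(a) - div(b)`
for nonzero `a b : R`, where `div(a) = ∑_p ν_p(a)·p`. -/
def principalDivisors (R : Type u) [CommRing R] : Set (DivisorGroup R) :=
  { D | ∃ a b : R, a ≠ 0 ∧ b ≠ 0 ∧ ∃ va vb : ↥(heightOnePrimes R) → ℕ,
      (∀ p : ↥(heightOnePrimes R),
          @ordAt R _ p.1.asIdeal p.1.isPrime a = va p ∧
          @ordAt R _ p.1.asIdeal p.1.isPrime b = vb p) ∧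
      ∀ p : ↥(heightOnePrimes R), D p = (va p : ℤ) - (vb p : ℤ) }

/-- The (Weil) divisor class group of `R`: Weil divisors modulo principal divisors. -/
def ClassGrp (R : Type u) [CommRing R] : Type u :=
  DivisorGroup R ⧸ AddSubgroup.closure (principalDivisors R)

noncomputable instance (R : Type u) [CommRing R] : AddCommGroup (ClassGrp R) :=
  inferInstanceAs (AddCommGroup (DivisorGroup R ⧸ AddSubgroup.closure (principalDivisors R)))

/-- The class of a height one prime in the divisor class group. -/
noncomputable def ClassGrp.mkPrime {R : Type u} [CommRing R] (p : ↥(heightOnePrimes R)) :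
    ClassGrp R :=
  QuotientAddGroup.mk (Finsupp.single p 1)

open MvPolynomial

/-- The ideal `(uv - f₁^{a₁} ⋯ f_t^{a_t})` of the polynomial ring `ℂ[u,v,x₁,…,xₙ]`,
where `u, v` are the two variables indexed by `Fin 2` and `x₁, …, xₙ` are the variables
indexed by `Fin n`, and the `fᵢ` are polynomials in the variables `x₁, …, xₙ` only. -/
noncomputable def hyperIdeal (n t : ℕ) (f : Fin t → MvPolynomial (Fin n) ℂ)
    (a : Fin t → ℕ) : Ideal (MvPolynomial (Fin 2 ⊕ Fin n) ℂ) :=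
  Ideal.span
    {X (Sum.inl 0) * X (Sum.inl 1) - ∏ i, (rename Sum.inr (f i)) ^ a i}

/-- The hypersurface ring `A = ℂ[u,v,x₁,…,xₙ]/(uv - f₁^{a₁} ⋯ f_t^{a_t})`. -/
abbrev HyperRing (n t : ℕ) (f : Fin t → MvPolynomial (Fin n) ℂ) (a : Fin t → ℕ) : Type :=
  MvPolynomial (Fin 2 ⊕ Fin n) ℂ ⧸ hyperIdeal n t f a

/-- The image of the variable `u` in the hypersurface ring `A`. -/
noncomputable def uElem (n t : ℕ) (f : Fin t → MvPolynomial (Fin n) ℂ) (a : Fin t → ℕ) :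
    HyperRing n t f a :=
  Ideal.Quotient.mk (hyperIdeal n t f a) (X (Sum.inl 0))

set_option linter.unusedSectionVars false

/-! ### Local orders -/

/-- `π` generates `p` locally at `p`. -/
structure IsUnif {R : Type u} [CommRing R] (p : Ideal R) (π : R) : Prop where
  mem : π ∈ p
  ne : π ≠ 0
  gen : ∀ x ∈ p, ∃ s, s ∉ p ∧ ∃ y, s * x = y * π

/-- elementary form of the order. -/
def HasOrd {R : Type u} [CommRing R] (p : Ideal R) (π x : R) (n : ℕ) : Prop :=
  ∃ s, s ∉ p ∧ ∃ b, b ∉ p ∧ s * x = b * π ^ n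

section local_ord

variable {R : Type u} [CommRing R] [IsDomain R] {p : Ideal R} [hp : p.IsPrime] {π : R}

theorem HasOrd.mul {x y : R} {m n : ℕ} (hx : HasOrd p π x m) (hy : HasOrd p π y n) :
    HasOrd p π (x * y) (m + n) := by
  obtain ⟨s, hs, b, hb, e⟩ := hx
  obtain ⟨s', hs', b', hb', e'⟩ := hy
  refine ⟨s * s', fun h => (hp.mem_or_mem h).elim hs hs', b * b',
    fun h => (hp.mem_or_mem h).elim hb hb', ?_⟩
  rw [pow_add]
  linear_combination s' * y * e + b * π ^ m * e'

theorem IsUnif.map_eq (h : IsUnif p π) : Ideal.map (algebraMap R (Localization.AtPrime p)) p =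
    Ideal.span {algebraMap R (Localization.AtPrime p) π} := by
  apply le_antisymm
  · rw [Ideal.map_le_iff_le_comap]
    intro x hx
    obtain ⟨s, hs, y, e⟩ := h.gen x hx
    rw [Ideal.mem_comap, Ideal.mem_span_singleton]
    have hu : IsUnit (algebraMap R (Localization.AtPrime p) s) :=
      IsLocalization.map_units (M := p.primeCompl) _ ⟨s, hs⟩
    have e' := congrArg (algebraMap R (Localization.AtPrime p)) e
    rw [map_mul, map_mul] at e'
    rw [← hu.dvd_mul_left, e']
    exact dvd_mul_left _ _
  · rw [Ideal.span_singleton_le_iff_mem]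
    exact Ideal.mem_map_of_mem _ h.mem

theorem IsUnif.not_isUnit (h : IsUnif p π) :
    ¬ IsUnit (algebraMap R (Localization.AtPrime p) π) := by
  intro hu
  exact (IsLocalization.AtPrime.isUnit_to_map_iff (Localization.AtPrime p) p π).1 hu h.mem

theorem IsUnif.map_ne (h : IsUnif p π) :
    algebraMap R (Localization.AtPrime p) π ≠ 0 := by
  intro h0
  apply h.ne
  exact IsLocalization.injective (Localization.AtPrime p) p.primeCompl_le_nonZeroDivisors
    (by rw [h0, map_zero])

theorem HasOrd.ordAt_eq (h : IsUnif p π) {x : R} {n : ℕ} (hx : HasOrd p π x n) :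
    ordAt R p x = n := by
  obtain ⟨s, hs, b, hb, e⟩ := hx
  have key : ∀ k : ℕ, algebraMap R (Localization.AtPrime p) x ∈
      Ideal.map (algebraMap R (Localization.AtPrime p)) p ^ k ↔ k ≤ n := by
    intro k
    rw [h.map_eq, Ideal.span_singleton_pow, Ideal.mem_span_singleton]
    have hu : IsUnit (algebraMap R (Localization.AtPrime p) s) :=
      IsLocalization.map_units (M := p.primeCompl) _ ⟨s, hs⟩
    have hv : IsUnit (algebraMap R (Localization.AtPrime p) b) :=
      IsLocalization.map_units (M := p.primeCompl) _ ⟨b, hb⟩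
    have e' := congrArg (algebraMap R (Localization.AtPrime p)) e
    rw [map_mul, map_mul, map_pow] at e'
    rw [← hu.dvd_mul_left, e', hv.dvd_mul_left]
    exact pow_dvd_pow_iff h.map_ne h.not_isUnit
  unfold ordAt
  apply le_antisymm
  · refine iSup₂_le fun k hk => ?_
    exact_mod_cast (key k).1 hk
  · exact le_iSup₂_of_le n ((key n).2 le_rfl) le_rfl

theorem IsUnif.exists_hasOrd [IsNoetherianRing R] (h : IsUnif p π) {x : R} (hx : x ≠ 0) :
    ∃ n, HasOrd p π x n := by
  have hx' : algebraMap R (Localization.AtPrime p) x ≠ 0 := by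
    intro h0
    apply hx
    exact IsLocalization.injective (Localization.AtPrime p) p.primeCompl_le_nonZeroDivisors
      (by rw [h0, map_zero])
  have : IsNoetherianRing (Localization.AtPrime p) :=
    IsLocalization.isNoetherianRing p.primeCompl _ inferInstance
  obtain ⟨n, c, hc, e⟩ := WfDvdMonoid.max_power_factor' hx' h.not_isUnit
  obtain ⟨⟨b, s⟩, hbs⟩ := IsLocalization.surj p.primeCompl c
  refine ⟨n, s, s.2, b, ?_, ?_⟩
  · intro hb
    apply hc
    have : algebraMap R (Localization.AtPrime p) b ∈
      Ideal.map (algebraMap R (Localization.AtPrime p)) p := Ideal.mem_map_of_mem _ hb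
    rw [h.map_eq, Ideal.mem_span_singleton] at this
    have hu : IsUnit (algebraMap R (Localization.AtPrime p) s) :=
      IsLocalization.map_units (M := p.primeCompl) _ s
    rw [← hu.dvd_mul_right, hbs]
    exact this
  · apply IsLocalization.injective (Localization.AtPrime p) p.primeCompl_le_nonZeroDivisors
    rw [map_mul, map_mul, map_pow, e]
    simp only at hbs
    rw [← hbs]
    ring

theorem height_one_iff (P : PrimeSpectrum R) : P ∈ heightOnePrimes R ↔
    P.asIdeal ≠ ⊥ ∧ ∀ q : Ideal R, q.IsPrime → q ≠ ⊥ → q ≤ P.asIdeal → q = P.asIdeal := by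
  have hmin : ∀ Q : PrimeSpectrum R, IsMin Q ↔ Q.asIdeal = ⊥ := by
    intro Q
    constructor
    · intro h
      have h2 : (⟨⊥, Ideal.isPrime_bot⟩ : PrimeSpectrum R) ≤ Q := by
        rw [← PrimeSpectrum.asIdeal_le_asIdeal]; exact bot_le
      have := h h2
      rw [← PrimeSpectrum.asIdeal_le_asIdeal] at this
      exact le_bot_iff.1 this
    · intro h Q' _
      rw [← PrimeSpectrum.asIdeal_le_asIdeal, h]; exact bot_le
  have h1 : P ∈ heightOnePrimes R ↔ ¬ IsMin P ∧ ∀ Q < P, IsMin Q := by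
    have h2 := Order.height_le_coe_iff (x := P) (n := 1)
    simp only [Nat.cast_one, Order.lt_one_iff, Order.height_eq_zero] at h2
    rw [← h2, ← Order.height_ne_zero, ← Order.one_le_iff_ne_zero, and_comm]
    exact le_antisymm_iff
  rw [h1, hmin]
  refine and_congr_right fun _ => ⟨fun h q hq hq0 hle => ?_, fun h Q hQ => ?_⟩
  · by_contra hne
    refine hq0 ((hmin ⟨q, hq⟩).1 (h ⟨q, hq⟩ ?_))
    rw [← PrimeSpectrum.asIdeal_lt_asIdeal]
    exact lt_of_le_of_ne hle hne
  · rw [hmin]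
    by_contra hQ0
    rw [← PrimeSpectrum.asIdeal_lt_asIdeal] at hQ
    exact hQ.ne (h _ Q.2 hQ0 hQ.le)

theorem IsUnif.height_one [IsNoetherianRing R] (h : IsUnif p π) :
    (⟨p, hp⟩ : PrimeSpectrum R) ∈ heightOnePrimes R := by
  rw [height_one_iff]
  refine ⟨fun hb => h.ne ?_, fun q hq hq0 hle => le_antisymm hle fun x hx => ?_⟩
  · have := h.mem
    simp only at hb
    rwa [hb, Ideal.mem_bot] at this
  · obtain ⟨y, hy, hy0⟩ := Submodule.exists_mem_ne_zero_of_ne_bot hq0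
    obtain ⟨n, s, hs, b, hb, e⟩ := h.exists_hasOrd hy0
    have h1 : b * π ^ n ∈ q := e ▸ q.mul_mem_left s hy
    have h2 : π ∈ q :=
      hq.mem_of_pow_mem n ((hq.mem_or_mem h1).resolve_left fun h => hb (hle h))
    obtain ⟨s', hs', z, e'⟩ := h.gen x hx
    have h3 : s' * x ∈ q := e' ▸ q.mul_mem_left z h2
    exact (hq.mem_or_mem h3).resolve_left fun h => hs' (hle h)

end local_ord

/-- order as a natural number -/
noncomputable def ordN {R : Type u} [CommRing R] (p : PrimeSpectrum R) (x : R) : ℕ :=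
  (@ordAt R _ p.asIdeal p.isPrime x).toNat

section ordN

variable {R : Type u} [CommRing R] [IsDomain R] {p : PrimeSpectrum R} {π : R}

theorem HasOrd.ordN_eq (h : IsUnif p.asIdeal π) {x : R} {n : ℕ}
    (hx : HasOrd p.asIdeal π x n) : ordN p x = n := by
  have := p.isPrime
  unfold ordN
  rw [hx.ordAt_eq h]; rfl

theorem IsUnif.ordAt_coe [IsNoetherianRing R] (h : IsUnif p.asIdeal π) {x : R} (hx : x ≠ 0) :
    @ordAt R _ p.asIdeal p.isPrime x = ordN p x := by
  have := p.isPrime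
  obtain ⟨n, hn⟩ := h.exists_hasOrd hx
  rw [hn.ordN_eq h, hn.ordAt_eq h]

theorem IsUnif.ordN_mul [IsNoetherianRing R] (h : IsUnif p.asIdeal π) {x y : R} (hx : x ≠ 0)
    (hy : y ≠ 0) : ordN p (x * y) = ordN p x + ordN p y := by
  have := p.isPrime
  obtain ⟨n, hn⟩ := h.exists_hasOrd hx
  obtain ⟨m, hm⟩ := h.exists_hasOrd hy
  rw [hn.ordN_eq h, hm.ordN_eq h, (hn.mul hm).ordN_eq h]

theorem IsUnif.ordN_not_mem (h : IsUnif p.asIdeal π) {x : R} (hx : x ∉ p.asIdeal) :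
    ordN p x = 0 :=
  HasOrd.ordN_eq h ⟨1, fun h1 => p.isPrime.ne_top ((Ideal.eq_top_iff_one _).2 h1), x, hx, by simp⟩

theorem IsUnif.ordN_one (h : IsUnif p.asIdeal π) : ordN p (1 : R) = 0 :=
  h.ordN_not_mem fun h1 => p.isPrime.ne_top ((Ideal.eq_top_iff_one _).2 h1)

theorem IsUnif.ordN_isUnit (h : IsUnif p.asIdeal π) {x : R} (hx : IsUnit x) : ordN p x = 0 :=
  h.ordN_not_mem fun h1 => p.isPrime.ne_top (Ideal.eq_top_of_isUnit_mem _ h1 hx)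

theorem IsUnif.ordN_pow [IsNoetherianRing R] (h : IsUnif p.asIdeal π) {x : R} (hx : x ≠ 0)
    (k : ℕ) : ordN p (x ^ k) = k * ordN p x := by
  induction k with
  | zero => rw [pow_zero, h.ordN_one, Nat.zero_mul]
  | succ k ih => rw [pow_succ, h.ordN_mul (pow_ne_zero _ hx) hx, ih]; ring

theorem IsUnif.ordN_self (h : IsUnif p.asIdeal π) : ordN p π = 1 :=
  HasOrd.ordN_eq h ⟨1, fun h1 => p.isPrime.ne_top ((Ideal.eq_top_iff_one _).2 h1), 1,
    fun h1 => p.isPrime.ne_top ((Ideal.eq_top_iff_one _).2 h1), by simp⟩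

/-- description of principal divisors as a subgroup -/
theorem mem_closure_principal [IsNoetherianRing R]
    (hU : ∀ p ∈ heightOnePrimes R, ∃ π, IsUnif p.asIdeal π) (D : DivisorGroup R) :
    D ∈ AddSubgroup.closure (principalDivisors R) ↔ ∃ a b : R, a ≠ 0 ∧ b ≠ 0 ∧
      ∀ p : ↥(heightOnePrimes R), D p = (ordN p.1 a : ℤ) - ordN p.1 b := by
  constructor
  · intro h
    induction h using AddSubgroup.closure_induction with
    | mem D hD =>
      obtain ⟨a, b, ha, hb, va, vb, h1, h2⟩ := hD
      refine ⟨a, b, ha, hb, fun p => ?_⟩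
      rw [h2]
      unfold ordN
      rw [(h1 p).1, (h1 p).2]; rfl
    | zero => exact ⟨1, 1, one_ne_zero, one_ne_zero, fun p => by simp⟩
    | add D E _ _ hD hE =>
      obtain ⟨a, b, ha, hb, h1⟩ := hD
      obtain ⟨a', b', ha', hb', h1'⟩ := hE
      refine ⟨a * a', b * b', mul_ne_zero ha ha', mul_ne_zero hb hb', fun p => ?_⟩
      obtain ⟨π, hπ⟩ := hU p.1 p.2
      rw [hπ.ordN_mul ha ha', hπ.ordN_mul hb hb', Finsupp.add_apply, h1, h1']
      push_cast
      ring
    | neg D _ hD =>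
      obtain ⟨a, b, ha, hb, h1⟩ := hD
      refine ⟨b, a, hb, ha, fun p => ?_⟩
      rw [Finsupp.neg_apply, h1]
      ring
  · rintro ⟨a, b, ha, hb, h⟩
    apply AddSubgroup.subset_closure
    refine ⟨a, b, ha, hb, fun p => ordN p.1 a, fun p => ordN p.1 b, fun p => ?_, h⟩
    obtain ⟨π, hπ⟩ := hU p.1 p.2
    exact ⟨hπ.ordAt_coe ha, hπ.ordAt_coe hb⟩

end ordN

/-- `R` sits between `S` and `S[1/w]`, with `w` a prime element. -/
structure NagSetup {R : Type u} {S : Type v} [CommRing R] [CommRing S] (ι : S →+* R) (w : S) :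
    Prop where
  inj : Function.Injective ι
  prime : Prime w
  surj : ∀ h : R, ∃ (k : ℕ) (c : S), ι w ^ k * h = ι c

section abstract_nagata

variable {R : Type u} {S : Type v} [CommRing R] [IsDomain R] [CommRing S] [IsDomain S]
  {ι : S →+* R} {w : S}

/-- The prime of `R` attached to the prime element `g` of `S`, where `R ⊆ S[1/w]`. -/
def Qid (H : NagSetup ι w) (g : S) : Ideal R where
  carrier := {h | ∃ (k : ℕ) (c : S), ι w ^ k * h = ι (g * c)}
  zero_mem' := ⟨0, 0, by simp⟩
  add_mem' := by
    rintro x y ⟨k, c, e⟩ ⟨k', c', e'⟩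
    refine ⟨k + k', w ^ k' * c + w ^ k * c', ?_⟩
    simp only [map_mul, map_add, map_pow] at *
    rw [pow_add]
    linear_combination ι w ^ k' * e + ι w ^ k * e'
  smul_mem' := by
    rintro r x ⟨k, c, e⟩
    obtain ⟨l, d, e'⟩ := H.surj r
    refine ⟨l + k, d * c, ?_⟩
    simp only [map_mul, smul_eq_mul] at *
    rw [pow_add]
    linear_combination ι w ^ k * x * e' + ι d * e

theorem NagSetup.w_ne (H : NagSetup ι w) : ι w ≠ 0 := fun h =>
  H.prime.ne_zero (H.inj (by rw [h, map_zero]))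

theorem mem_Qid_iff (H : NagSetup ι w) {g : S} (hg : Prime g) (hgw : ¬ g ∣ w) {x : R} {k : ℕ}
    {c : S} (e : ι w ^ k * x = ι c) : x ∈ Qid H g ↔ g ∣ c := by
  constructor
  · rintro ⟨l, d, e'⟩
    have h1 : w ^ l * c = w ^ k * (g * d) := by
      apply H.inj
      simp only [map_mul, map_pow] at *
      linear_combination (-ι w ^ l) * e + ι w ^ k * e'
    have h2 : g ∣ w ^ l * c := h1 ▸ Dvd.intro_left (w ^ k * d) (by ring)
    exact (hg.dvd_or_dvd h2).resolve_left fun h => hgw (hg.dvd_of_dvd_pow h)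
  · rintro ⟨d, rfl⟩
    exact ⟨k, d, e⟩

theorem mem_Qid_iff' (H : NagSetup ι w) {g : S} (hg : Prime g) (hgw : ¬ g ∣ w) {c : S} :
    ι c ∈ Qid H g ↔ g ∣ c :=
  mem_Qid_iff H hg hgw (k := 0) (by simp)

theorem Qid_prime (H : NagSetup ι w) {g : S} (hg : Prime g) (hgw : ¬ g ∣ w) :
    (Qid H g).IsPrime := by
  refine ⟨fun h => ?_, fun {x y} h => ?_⟩
  · have h1 : ι 1 ∈ Qid H g := h ▸ Submodule.mem_top
    rw [mem_Qid_iff' H hg hgw] at h1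
    exact hg.not_isUnit (isUnit_of_dvd_one h1)
  · obtain ⟨k, c, e⟩ := H.surj x
    obtain ⟨l, d, e'⟩ := H.surj y
    have h3 : ι w ^ (k + l) * (x * y) = ι (c * d) := by
      rw [map_mul, ← e, ← e']; ring
    rw [mem_Qid_iff H hg hgw h3] at h
    rw [mem_Qid_iff H hg hgw e, mem_Qid_iff H hg hgw e']
    exact hg.dvd_or_dvd h

theorem Qid_unif (H : NagSetup ι w) {g : S} (hg : Prime g) (hgw : ¬ g ∣ w) :
    IsUnif (Qid H g) (ι g) := by
  have := Qid_prime H hg hgw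
  refine ⟨(mem_Qid_iff' H hg hgw).2 dvd_rfl, fun h => hg.ne_zero (H.inj (by rw [h, map_zero])), ?_⟩
  rintro x ⟨k, c, e⟩
  refine ⟨ι w ^ k, fun h => hgw ?_, ι c, by rw [e, map_mul, mul_comm]⟩
  exact (mem_Qid_iff' H hg hgw).1 (this.mem_of_pow_mem _ h)

theorem Qid_ord (H : NagSetup ι w) {g : S} (hg : Prime g) (hgw : ¬ g ∣ w) {c : S} {n : ℕ}
    (hc : ¬ g ∣ c) : ordN ⟨Qid H g, Qid_prime H hg hgw⟩ (ι (g ^ n * c)) = n := by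
  have hu := Qid_unif H hg hgw
  refine HasOrd.ordN_eq (p := ⟨Qid H g, Qid_prime H hg hgw⟩) hu ⟨1, ?_, ι c, ?_, ?_⟩
  · exact fun h1 => (Qid_prime H hg hgw).ne_top ((Ideal.eq_top_iff_one _).2 h1)
  · exact fun h => hc ((mem_Qid_iff' H hg hgw).1 h)
  · rw [map_mul, map_pow]; ring

theorem exists_Qid_le [UniqueFactorizationMonoid S] (H : NagSetup ι w) {q : Ideal R}
    (hq : q.IsPrime) (hq0 : q ≠ ⊥) (hw : ι w ∉ q) :
    ∃ g, Prime g ∧ ¬ g ∣ w ∧ ι g ∈ q ∧ Qid H g ≤ q := by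
  have h0 : q.comap ι ≠ ⊥ := by
    obtain ⟨y, hy, hy0⟩ := Submodule.exists_mem_ne_zero_of_ne_bot hq0
    obtain ⟨k, c, e⟩ := H.surj y
    intro h
    have hc : c ∈ q.comap ι := by rw [Ideal.mem_comap, ← e]; exact q.mul_mem_left _ hy
    rw [h, Ideal.mem_bot] at hc
    rw [hc, map_zero] at e
    exact mul_ne_zero (pow_ne_zero k H.w_ne) hy0 e
  obtain ⟨g, hg, hgp⟩ := Ideal.IsPrime.exists_mem_prime_of_ne_bot (hq.comap ι) h0
  rw [Ideal.mem_comap] at hg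
  refine ⟨g, hgp, fun ⟨d, h⟩ => hw ?_, hg, ?_⟩
  · rw [h, map_mul]; exact q.mul_mem_right _ hg
  · rintro x ⟨k, c, e⟩
    have h1 : ι w ^ k * x ∈ q := by rw [e, map_mul]; exact q.mul_mem_right _ hg
    exact (hq.mem_or_mem h1).resolve_left fun h => hw (hq.mem_of_pow_mem _ h)

theorem Qid_ne_bot (H : NagSetup ι w) {g : S} (hg : Prime g) (hgw : ¬ g ∣ w) : Qid H g ≠ ⊥ := by
  intro h
  have h1 := Qid_unif H hg hgw
  have h2 := h1.mem
  rw [h, Ideal.mem_bot] at h2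
  exact h1.ne h2

theorem eq_Qid_of_height_one [UniqueFactorizationMonoid S] (H : NagSetup ι w)
    {q : PrimeSpectrum R} (hq : q ∈ heightOnePrimes R) (hw : ι w ∉ q.asIdeal) :
    ∃ g, Prime g ∧ ¬ g ∣ w ∧ q.asIdeal = Qid H g := by
  rw [height_one_iff] at hq
  obtain ⟨g, hg, hgw, -, hle⟩ := exists_Qid_le H q.isPrime hq.1 hw
  exact ⟨g, hg, hgw, (hq.2 _ (Qid_prime H hg hgw) (Qid_ne_bot H hg hgw) hle).symm⟩

/-- If `α` and `β` have the same multiplicities away from `w`, they agree up to a unit and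
powers of `w`. -/
theorem associated_of_mult [UniqueFactorizationMonoid S] (hw : Prime w) {α β : S} (hα : α ≠ 0)
    (hβ : β ≠ 0)
    (h : ∀ g, Prime g → ¬ g ∣ w → emultiplicity g α = emultiplicity g β) :
    ∃ m m' : ℕ, Associated (w ^ m' * α) (w ^ m * β) := by
  have hfa := FiniteMultiplicity.of_prime_left hw hα
  have hfb := FiniteMultiplicity.of_prime_left hw hβ
  refine ⟨multiplicity w α, multiplicity w β, ?_⟩
  have key : ∀ g, Prime g → emultiplicity g (w ^ multiplicity w β * α) =
      emultiplicity g (w ^ multiplicity w α * β) := by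
    intro g hg
    rw [emultiplicity_mul hg, emultiplicity_mul hg]
    by_cases hgw : g ∣ w
    · have ha : Associated g w := hg.associated_of_dvd hw hgw
      have e1 : ∀ x, emultiplicity g x = emultiplicity w x := fun x =>
        emultiplicity_eq_of_associated_left ha.symm
      simp only [e1, emultiplicity_pow_self_of_prime hw]
      rw [hfa.emultiplicity_eq_multiplicity, hfb.emultiplicity_eq_multiplicity, add_comm]
    · have e0 : ∀ k : ℕ, emultiplicity g (w ^ k) = 0 := fun k =>
        emultiplicity_eq_zero.2 fun h => hgw (hg.dvd_of_dvd_pow h)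
      rw [e0, e0, h g hg hgw]
  apply associated_of_dvd_dvd
  · rw [UniqueFactorizationMonoid.dvd_iff_emultiplicity_le
      (mul_ne_zero (pow_ne_zero _ hw.ne_zero) hα)]
    exact fun g hg => (key g hg).le
  · rw [UniqueFactorizationMonoid.dvd_iff_emultiplicity_le
      (mul_ne_zero (pow_ne_zero _ hw.ne_zero) hβ)]
    exact fun g hg => (key g hg).ge

theorem emult_eq_ordN [UniqueFactorizationMonoid S] (H : NagSetup ι w) {g : S} (hg : Prime g)
    (hgw : ¬ g ∣ w) {α : S} (hα : α ≠ 0) :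
    emultiplicity g α = ordN ⟨Qid H g, Qid_prime H hg hgw⟩ (ι α) := by
  have hf := FiniteMultiplicity.of_prime_left hg hα
  obtain ⟨c, hc, hn⟩ := hf.exists_eq_pow_mul_and_not_dvd
  rw [hf.emultiplicity_eq_multiplicity]
  generalize multiplicity g α = n at *
  subst hc
  rw [Qid_ord H hg hgw hn]

theorem nagata_abstract [IsNoetherianRing R] [UniqueFactorizationMonoid S] (H : NagSetup ι w)
    {t : ℕ} (P : Fin t → Ideal R) (hP : ∀ i, (P i).IsPrime) (f : Fin t → R) (a : Fin t → ℕ)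
    (hf : ∀ i, IsUnif (P i) (f i)) (hwP : ∀ i, ι w ∈ P i)
    (hmin : ∀ Q : Ideal R, Q.IsPrime → ι w ∈ Q → ∃ i, P i ≤ Q)
    (hinc : ∀ i j, P i ≤ P j → i = j)
    (hord : ∀ i, HasOrd (P i) (f i) (ι w) (a i)) :
    Nonempty (ClassGrp R ≃+
        ((Fin t → ℤ) ⧸ AddSubgroup.zmultiples fun i : Fin t => (a i : ℤ))) := by
  classical
  let PP : Fin t → ↥(heightOnePrimes R) := fun i =>
    ⟨⟨P i, hP i⟩, by have := hP i; exact (hf i).height_one⟩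
  have hPU : ∀ i, IsUnif (PP i).1.asIdeal (f i) := hf
  have hPPinj : Function.Injective PP := fun i j h => hinc i j (by
    have : (PP i).1.asIdeal = (PP j).1.asIdeal := by rw [h]
    exact this.le)
  have hbot : ∀ i, P i ≠ ⊥ := fun i h => (hf i).ne (by
    have := (hf i).mem
    rwa [h, Ideal.mem_bot] at this)
  have hclass : ∀ p : ↥(heightOnePrimes R), ι w ∈ p.1.asIdeal → ∃ i, p = PP i := by
    intro p hp
    obtain ⟨i, hi⟩ := hmin _ p.1.isPrime hp
    refine ⟨i, ?_⟩
    have h1 := ((height_one_iff p.1).1 p.2).2 _ (hP i) (hbot i) hi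
    apply Subtype.ext
    apply PrimeSpectrum.ext
    exact h1.symm
  have hU : ∀ p ∈ heightOnePrimes R, ∃ π, IsUnif p.asIdeal π := by
    intro p hp
    by_cases hw : ι w ∈ p.asIdeal
    · obtain ⟨i, hi⟩ := hclass ⟨p, hp⟩ hw
      refine ⟨f i, ?_⟩
      have := hPU i
      rwa [← hi] at this
    · obtain ⟨g, hg, hgw, e⟩ := eq_Qid_of_height_one H hp hw
      exact ⟨ι g, e ▸ Qid_unif H hg hgw⟩
  have hordw : ∀ i, ordN (PP i).1 (ι w) = a i := fun i => (hord i).ordN_eq (hPU i)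
  have hPw : ∀ i, ι w ∈ (PP i).1.asIdeal := hwP
  -- the map
  let E : (Fin t → ℤ) →+ DivisorGroup R :=
    ∑ i, (Finsupp.singleAddHom (PP i)).comp (Pi.evalAddMonoidHom (fun _ : Fin t => ℤ) i)
  have hE : ∀ c, E c = ∑ i, Finsupp.single (PP i) (c i) := by
    intro c
    simp [E]
  have hE1 : ∀ c i, E c (PP i) = c i := by
    intro c i
    rw [hE, Finsupp.finsetSum_apply, Finset.sum_eq_single i]
    · simp
    · intro j _ hj
      rw [Finsupp.single_apply, if_neg fun h => hj (hPPinj h)]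
    · simp
  have hE2 : ∀ c (p : ↥(heightOnePrimes R)), ι w ∉ p.1.asIdeal → E c p = 0 := by
    intro c p hp
    rw [hE, Finsupp.finsetSum_apply]
    refine Finset.sum_eq_zero fun j _ => ?_
    rw [Finsupp.single_apply, if_neg fun h : PP j = p => hp (h ▸ hPw j)]
  let N := AddSubgroup.closure (principalDivisors R)
  let ψ : (Fin t → ℤ) →+ (DivisorGroup R ⧸ N) := (QuotientAddGroup.mk' N).comp E
  have hker : ψ.ker = AddSubgroup.zmultiples fun i : Fin t => (a i : ℤ) := by
    ext c
    rw [AddMonoidHom.mem_ker, AddSubgroup.mem_zmultiples_iff]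
    have h0 : ψ c = 0 ↔ E c ∈ N := QuotientAddGroup.eq_zero_iff _
    rw [h0, mem_closure_principal hU]
    constructor
    · rintro ⟨x, y, hx, hy, hD⟩
      obtain ⟨k, α, hα⟩ := H.surj x
      obtain ⟨l, β, hβ⟩ := H.surj y
      have hια : ι α ≠ 0 := hα ▸ mul_ne_zero (pow_ne_zero k H.w_ne) hx
      have hιβ : ι β ≠ 0 := hβ ▸ mul_ne_zero (pow_ne_zero l H.w_ne) hy
      have hα0 : α ≠ 0 := fun h => hια (by rw [h, map_zero])
      have hβ0 : β ≠ 0 := fun h => hιβ (by rw [h, map_zero])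
      have hmult : ∀ g, Prime g → ¬ g ∣ w → emultiplicity g α = emultiplicity g β := by
        intro g hg hgw
        rw [emult_eq_ordN H hg hgw hα0, emult_eq_ordN H hg hgw hβ0]
        have := Qid_prime H hg hgw
        have hu := Qid_unif H hg hgw
        let q : ↥(heightOnePrimes R) := ⟨⟨Qid H g, this⟩, hu.height_one⟩
        have hu' : IsUnif q.1.asIdeal (ι g) := hu
        have hwq : ι w ∉ q.1.asIdeal := fun h => hgw ((mem_Qid_iff' H hg hgw).1 h)
        have h1 := hD q
        rw [hE2 c q hwq] at h1
        have h2 : ordN q.1 (ι α) = ordN q.1 (ι β) := by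
          rw [← hα, ← hβ, hu'.ordN_mul (pow_ne_zero k H.w_ne) hx,
            hu'.ordN_mul (pow_ne_zero l H.w_ne) hy, hu'.ordN_pow H.w_ne, hu'.ordN_pow H.w_ne,
            hu'.ordN_not_mem hwq]
          omega
        exact congrArg _ h2
      obtain ⟨m, m', ε, hε⟩ := associated_of_mult H.prime hα0 hβ0 hmult
      refine ⟨(m : ℤ) + l - (m' + k), ?_⟩
      funext i
      have hu := hPU i
      have h1 := hD (PP i)
      rw [hE1] at h1
      have h2 := congrArg (fun z => ordN (PP i).1 (ι z)) hε
      have hε' : IsUnit (ι (ε : S)) := ε.isUnit.map ι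
      simp only [map_mul, map_pow] at h2
      rw [hu.ordN_mul (mul_ne_zero (pow_ne_zero _ H.w_ne) hια) hε'.ne_zero,
        hu.ordN_isUnit hε', hu.ordN_mul (pow_ne_zero _ H.w_ne) hια,
        hu.ordN_mul (pow_ne_zero _ H.w_ne) hιβ, ← hα, ← hβ,
        hu.ordN_mul (pow_ne_zero _ H.w_ne) hx, hu.ordN_mul (pow_ne_zero _ H.w_ne) hy,
        hu.ordN_pow H.w_ne, hu.ordN_pow H.w_ne, hu.ordN_pow H.w_ne, hu.ordN_pow H.w_ne,
        hordw] at h2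
      rw [h1, Pi.smul_apply, smul_eq_mul]
      have h3 := congrArg (Nat.cast (R := ℤ)) h2
      push_cast at h3
      linear_combination -h3
    · rintro ⟨m, rfl⟩
      have key : ∀ m : ℕ, ∀ p : ↥(heightOnePrimes R),
          E ((m : ℤ) • fun i => (a i : ℤ)) p = ordN p.1 (ι w ^ m) := by
        intro m p
        obtain ⟨π, hπ⟩ := hU p.1 p.2
        rw [hπ.ordN_pow H.w_ne]
        by_cases hp : ι w ∈ p.1.asIdeal
        · obtain ⟨i, rfl⟩ := hclass p hp
          rw [hE1, hordw]
          simp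
        · rw [hE2 _ _ hp, hπ.ordN_not_mem hp]
          simp
      obtain ⟨k, rfl | rfl⟩ := m.eq_nat_or_neg
      · refine ⟨ι w ^ k, 1, pow_ne_zero _ H.w_ne, one_ne_zero, fun p => ?_⟩
        obtain ⟨π, hπ⟩ := hU p.1 p.2
        rw [key, hπ.ordN_one]
        simp
      · refine ⟨1, ι w ^ k, one_ne_zero, pow_ne_zero _ H.w_ne, fun p => ?_⟩
        obtain ⟨π, hπ⟩ := hU p.1 p.2
        rw [neg_smul, map_neg, Finsupp.neg_apply, key, hπ.ordN_one]
        simp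
  have hsurj : Function.Surjective ψ := by
    intro z
    obtain ⟨D, rfl⟩ := QuotientAddGroup.mk'_surjective N z
    rw [← AddMonoidHom.mem_range]
    induction D using Finsupp.induction_linear with
    | zero => rw [map_zero]; exact zero_mem _
    | add D D' h h' => rw [map_add]; exact add_mem h h'
    | single p m =>
      have e1 : Finsupp.single p m = m • Finsupp.single p (1 : ℤ) := by simp
      rw [e1, map_zsmul]
      apply zsmul_mem
      by_cases hp : ι w ∈ p.1.asIdeal
      · obtain ⟨i, rfl⟩ := hclass p hp
        refine ⟨Pi.single i 1, ?_⟩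
        have : E (Pi.single i 1) = Finsupp.single (PP i) 1 := by
          rw [hE, Finset.sum_eq_single i]
          · simp
          · intro j _ hj
            simp [Pi.single_eq_of_ne hj]
          · simp
        simp only [ψ, AddMonoidHom.comp_apply, this]
      · obtain ⟨g, hg, hgw, e⟩ := eq_Qid_of_height_one H p.2 hp
        have hu : IsUnif p.1.asIdeal (ι g) := e ▸ Qid_unif H hg hgw
        refine ⟨-fun i => (ordN (PP i).1 (ι g) : ℤ), ?_⟩
        simp only [ψ, AddMonoidHom.comp_apply, QuotientAddGroup.mk'_apply]
        rw [QuotientAddGroup.eq, mem_closure_principal hU]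
        refine ⟨ι g, 1, hu.ne, one_ne_zero, fun q => ?_⟩
        obtain ⟨π, hπ⟩ := hU q.1 q.2
        rw [hπ.ordN_one, map_neg, neg_neg, Finsupp.add_apply]
        by_cases hq : ι w ∈ q.1.asIdeal
        · obtain ⟨i, rfl⟩ := hclass q hq
          rw [hE1, Finsupp.single_apply, if_neg fun h : p = PP i => hp (h ▸ hq)]
          simp
        · rw [hE2 _ _ hq]
          by_cases hpq : p = q
          · subst hpq
            rw [hu.ordN_self]
            simp
          · rw [Finsupp.single_apply, if_neg hpq, hπ.ordN_not_mem]
            · simp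
            · intro hgq
              apply hpq
              apply Subtype.ext
              apply PrimeSpectrum.ext
              refine ((height_one_iff q.1).1 q.2).2 _ p.1.isPrime
                ((height_one_iff p.1).1 p.2).1 ?_
              rw [e]
              rintro x ⟨k, c, e'⟩
              have h1 : ι w ^ k * x ∈ q.1.asIdeal := by
                rw [e', map_mul]; exact Ideal.mul_mem_right _ _ hgq
              exact (q.1.isPrime.mem_or_mem h1).resolve_left
                fun h => hq (q.1.isPrime.mem_of_pow_mem _ h)
  exact ⟨((QuotientAddGroup.quotientAddEquivOfEq hker.symm).trans
    (QuotientAddGroup.quotientKerEquivOfSurjective ψ hsurj)).symm⟩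

end abstract_nagata

section concrete

/-- `ℂ[u,v,x] ≃ ℂ[x][v][u]` -/
noncomputable def eqv (n : ℕ) : MvPolynomial (Fin 2 ⊕ Fin n) ℂ ≃+*
    Polynomial (MvPolynomial (Fin 1) (MvPolynomial (Fin n) ℂ)) :=
  ((sumAlgEquiv ℂ (Fin 2) (Fin n)).toRingEquiv).trans
    (finSuccEquiv (MvPolynomial (Fin n) ℂ) 1).toRingEquiv

theorem eqv_u (n : ℕ) : eqv n (X (Sum.inl 0)) = Polynomial.X := by
  have h : eqv n (X (Sum.inl 0)) = finSuccEquiv (MvPolynomial (Fin n) ℂ) 1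
    (sumAlgEquiv ℂ (Fin 2) (Fin n) (X (Sum.inl 0))) := rfl
  rw [h, sumAlgEquiv_X_inl, finSuccEquiv_X_zero]

theorem eqv_v (n : ℕ) : eqv n (X (Sum.inl 1)) = Polynomial.C (X 0) := by
  have h : eqv n (X (Sum.inl 1)) = finSuccEquiv (MvPolynomial (Fin n) ℂ) 1
    (sumAlgEquiv ℂ (Fin 2) (Fin n) (X (Sum.inl 1))) := rfl
  rw [h, sumAlgEquiv_X_inl]
  exact finSuccEquiv_X_succ (j := 0)

theorem eqv_x (n : ℕ) (b : MvPolynomial (Fin n) ℂ) :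
    eqv n (rename Sum.inr b) = Polynomial.C (C b) := by
  have h : eqv n (rename Sum.inr b) = finSuccEquiv (MvPolynomial (Fin n) ℂ) 1
    (sumAlgEquiv ℂ (Fin 2) (Fin n) (rename Sum.inr b)) := rfl
  have h2 : sumAlgEquiv ℂ (Fin 2) (Fin n) (rename Sum.inr b) = C b := by
    have := DFunLike.congr_fun (sumAlgEquiv_comp_rename_inr (R := ℂ) (S₁ := Fin 2) (S₂ := Fin n)) b
    simpa using this
  rw [h, h2]
  simp [finSuccEquiv_apply]

theorem exists_const_add {B : Type*} [CommRing B] (s : MvPolynomial (Fin 1) B) :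
    ∃ s', s = C (constantCoeff s) + X 0 * s' := by
  induction s using MvPolynomial.induction_on with
  | C r => exact ⟨0, by simp⟩
  | add p q hp hq =>
    obtain ⟨p', hp⟩ := hp
    obtain ⟨q', hq⟩ := hq
    refine ⟨p' + q', ?_⟩
    rw [map_add, map_add]
    linear_combination hp + hq
  | mul_X p i _ =>
    have : i = 0 := Subsingleton.elim _ _
    subst this
    exact ⟨p, by simp [mul_comm]⟩

variable (n t : ℕ) (f : Fin t → MvPolynomial (Fin n) ℂ) (a : Fin t → ℕ)

/-- the defining equation -/
noncomputable def defEq : MvPolynomial (Fin 2 ⊕ Fin n) ℂ :=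
  X (Sum.inl 0) * X (Sum.inl 1) - ∏ i, (rename Sum.inr (f i)) ^ a i

/-- the product -/
noncomputable def bigF : MvPolynomial (Fin n) ℂ := ∏ i, f i ^ a i

theorem eqv_defEq : eqv n (defEq n t f a) =
    Polynomial.C (X 0) * Polynomial.X + Polynomial.C (-(C (bigF n t f a))) := by
  unfold defEq bigF
  rw [map_sub, map_mul, map_prod, eqv_u, eqv_v]
  simp only [map_pow, eqv_x, map_neg, map_prod]
  ring

theorem defEq_prime (hirr : ∀ i, Irreducible (f i)) : Prime (defEq n t f a) := by
  rw [← MulEquiv.prime_iff (eqv n).toMulEquiv]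
  change Prime (eqv n (defEq n t f a))
  rw [eqv_defEq, ← UniqueFactorizationMonoid.irreducible_iff_prime]
  apply Polynomial.irreducible_C_mul_X_add_C (X_ne_zero 0)
  rw [(X_prime (R := MvPolynomial (Fin n) ℂ) (i := (0 : Fin 1))).irreducible.isRelPrime_iff_not_dvd,
    dvd_neg]
  rintro ⟨d, hd⟩
  have h := congrArg constantCoeff hd
  simp only [map_mul, constantCoeff_X, zero_mul, constantCoeff_C] at h
  exact Finset.prod_ne_zero_iff.2 (fun i _ => pow_ne_zero _ (hirr i).ne_zero) h

/-- quotient map from the iterated polynomial ring -/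
noncomputable def qmap : Polynomial (MvPolynomial (Fin 1) (MvPolynomial (Fin n) ℂ)) →+*
    HyperRing n t f a :=
  (Ideal.Quotient.mk (hyperIdeal n t f a)).comp (eqv n).symm.toRingHom

theorem qmap_surj : Function.Surjective (qmap n t f a) :=
  Ideal.Quotient.mk_surjective.comp (eqv n).symm.surjective

theorem qmap_eqv (x) : qmap n t f a (eqv n x) = Ideal.Quotient.mk (hyperIdeal n t f a) x := by
  simp [qmap]

theorem qmap_eq_zero (q) : qmap n t f a q = 0 ↔ eqv n (defEq n t f a) ∣ q := by
  obtain ⟨x, rfl⟩ := (eqv n).surjective q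
  rw [qmap_eqv, Ideal.Quotient.eq_zero_iff_mem, hyperIdeal, Ideal.mem_span_singleton]
  exact (map_dvd_iff (eqv n)).symm

/-- the inclusion of `ℂ[x][v]` -/
noncomputable def iot : MvPolynomial (Fin 1) (MvPolynomial (Fin n) ℂ) →+* HyperRing n t f a :=
  (qmap n t f a).comp Polynomial.C

theorem qmap_C (s) : qmap n t f a (Polynomial.C s) = iot n t f a s := rfl

theorem uv_eq : iot n t f a (X 0) * qmap n t f a Polynomial.X = iot n t f a (C (bigF n t f a)) := by
  have h := (qmap_eq_zero n t f a _).2 (dvd_refl (eqv n (defEq n t f a)))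
  rw [eqv_defEq, map_add, map_mul, qmap_C, qmap_C, map_neg] at h
  linear_combination h

theorem iot_inj : Function.Injective (iot n t f a) := by
  rw [injective_iff_map_eq_zero]
  intro s hs
  rw [← qmap_C, qmap_eq_zero, eqv_defEq] at hs
  have h1 := Polynomial.eq_zero_of_dvd_of_natDegree_lt hs (by
    rw [Polynomial.natDegree_C, Polynomial.natDegree_linear (X_ne_zero 0)]
    exact one_pos)
  exact Polynomial.C_eq_zero.1 h1

theorem nagSetup : NagSetup (iot n t f a) (X 0) where
  inj := iot_inj n t f a
  prime := X_prime
  surj := by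
    intro h
    obtain ⟨q, rfl⟩ := qmap_surj n t f a h
    induction q using Polynomial.induction_on' with
    | add p q hp hq =>
      obtain ⟨k, c, e⟩ := hp
      obtain ⟨l, d, e'⟩ := hq
      refine ⟨k + l, X 0 ^ l * c + X 0 ^ k * d, ?_⟩
      simp only [map_add, map_mul, map_pow]
      rw [pow_add]
      linear_combination iot n t f a (X 0) ^ l * e + iot n t f a (X 0) ^ k * e'
    | monomial m s =>
      refine ⟨m, s * C (bigF n t f a) ^ m, ?_⟩
      rw [← Polynomial.C_mul_X_pow_eq_monomial, map_mul, map_pow, map_mul, map_pow, ← uv_eq, qmap_C]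
      ring

/-- coefficient map -/
noncomputable def phi (i : Fin t) : MvPolynomial (Fin 1) (MvPolynomial (Fin n) ℂ) →+*
    MvPolynomial (Fin n) ℂ ⧸ Ideal.span {f i} :=
  (Ideal.Quotient.mk (Ideal.span {f i})).comp constantCoeff

theorem phi_eq_zero (i : Fin t) (s) : phi n t f i s = 0 ↔ f i ∣ constantCoeff s := by
  rw [← Ideal.mem_span_singleton, ← Ideal.Quotient.eq_zero_iff_mem]; rfl

/-- The primes over `v`. -/
noncomputable def Pid (i : Fin t) : Ideal (HyperRing n t f a) :=
  Ideal.map (qmap n t f a) (RingHom.ker (Polynomial.mapRingHom (phi n t f i)))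

variable {n t f a}

theorem defEq_mem (ha : ∀ i, 1 ≤ a i) (i : Fin t) :
    eqv n (defEq n t f a) ∈ RingHom.ker (Polynomial.mapRingHom (phi n t f i)) := by
  rw [RingHom.mem_ker, eqv_defEq, map_add, map_mul, Polynomial.coe_mapRingHom, Polynomial.map_C,
    Polynomial.map_C]
  have h1 : phi n t f i (X 0) = 0 := by rw [phi_eq_zero]; simp
  have h2 : phi n t f i (-(C (bigF n t f a))) = 0 := by
    rw [phi_eq_zero, map_neg, dvd_neg, constantCoeff_C]
    exact (dvd_pow_self _ (Nat.one_le_iff_ne_zero.1 (ha i))).trans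
      (Finset.dvd_prod_of_mem (fun i => f i ^ a i) (Finset.mem_univ i))
  rw [h1, h2]
  simp

theorem ker_qmap_le (ha : ∀ i, 1 ≤ a i) (i : Fin t) :
    RingHom.ker (qmap n t f a) ≤ RingHom.ker (Polynomial.mapRingHom (phi n t f i)) := by
  intro q hq
  rw [RingHom.mem_ker, qmap_eq_zero] at hq
  exact Ideal.mem_of_dvd _ hq (defEq_mem ha i)

theorem qmap_mem_Pid (ha : ∀ i, 1 ≤ a i) (i : Fin t) (q) : qmap n t f a q ∈ Pid n t f a i ↔
    Polynomial.map (phi n t f i) q = 0 := by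
  have h : Ideal.comap (qmap n t f a) (Pid n t f a i) =
      RingHom.ker (Polynomial.mapRingHom (phi n t f i)) := by
    rw [Pid, Ideal.comap_map_of_surjective' _ (qmap_surj n t f a)]
    exact sup_eq_left.2 (ker_qmap_le ha i)
  rw [← Ideal.mem_comap, h]; rfl

theorem iot_mem_Pid (ha : ∀ i, 1 ≤ a i) (i : Fin t) (s) : iot n t f a s ∈ Pid n t f a i ↔
    f i ∣ constantCoeff s := by
  rw [← qmap_C, qmap_mem_Pid ha, Polynomial.map_C, Polynomial.C_eq_zero, phi_eq_zero]

theorem Pid_prime (hirr : ∀ i, Irreducible (f i)) (ha : ∀ i, 1 ≤ a i) (i : Fin t) :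
    (Pid n t f a i).IsPrime := by
  have : (Ideal.span {f i}).IsPrime :=
    (Ideal.span_singleton_prime (hirr i).ne_zero).2 (hirr i).prime
  have h2 : IsDomain (MvPolynomial (Fin n) ℂ ⧸ Ideal.span {f i}) := Ideal.Quotient.isDomain _
  have h3 : (RingHom.ker (Polynomial.mapRingHom (phi n t f i))).IsPrime := RingHom.ker_isPrime _
  exact Ideal.map_isPrime_of_surjective (qmap_surj n t f a) (ker_qmap_le ha i)

theorem Pid_le (i : Fin t) (Q : Ideal (HyperRing n t f a)) (hv : iot n t f a (X 0) ∈ Q)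
    (hf : iot n t f a (C (f i)) ∈ Q) : Pid n t f a i ≤ Q := by
  rw [Pid, Ideal.map_le_iff_le_comap, Polynomial.ker_mapRingHom, Ideal.map_le_iff_le_comap]
  intro s hs
  rw [RingHom.mem_ker, phi_eq_zero] at hs
  obtain ⟨d, hd⟩ := hs
  obtain ⟨s', hs'⟩ := exists_const_add s
  rw [hd] at hs'
  rw [Ideal.mem_comap, Ideal.mem_comap, qmap_C, hs']
  simp only [map_add, map_mul]
  exact Q.add_mem (Q.mul_mem_right _ hf) (Q.mul_mem_right _ hv)

theorem u_not_mem (hirr : ∀ i, Irreducible (f i)) (ha : ∀ i, 1 ≤ a i) (i : Fin t) :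
    qmap n t f a Polynomial.X ∉ Pid n t f a i := by
  rw [qmap_mem_Pid ha, Polynomial.map_X]
  have : (Ideal.span {f i}).IsPrime :=
    (Ideal.span_singleton_prime (hirr i).ne_zero).2 (hirr i).prime
  exact Polynomial.X_ne_zero

theorem bigF_split (i : Fin t) :
    bigF n t f a = (∏ j ∈ Finset.univ.erase i, f j ^ a j) * f i ^ a i := by
  rw [bigF, Finset.prod_erase_mul _ _ (Finset.mem_univ i)]

theorem Pid_unif (hirr : ∀ i, Irreducible (f i)) (ha : ∀ i, 1 ≤ a i) (i : Fin t) :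
    IsUnif (Pid n t f a i) (iot n t f a (C (f i))) where
  mem := by rw [iot_mem_Pid ha, constantCoeff_C]
  ne := by
    rw [Ne, map_eq_zero_iff _ (iot_inj n t f a), C_eq_zero]
    exact (hirr i).ne_zero
  gen := by
    intro x hx
    refine ⟨qmap n t f a Polynomial.X, u_not_mem hirr ha i, ?_⟩
    have h1 := Pid_le i (Ideal.span {iot n t f a (X 0), iot n t f a (C (f i))})
      (Ideal.subset_span (by simp)) (Ideal.subset_span (by simp)) hx
    rw [Ideal.mem_span_pair] at h1
    obtain ⟨y, z, e⟩ := h1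
    obtain ⟨k, hk⟩ : ∃ k, a i = k + 1 := ⟨a i - 1, by have := ha i; omega⟩
    have h2 := uv_eq n t f a
    rw [bigF_split i, hk, pow_succ] at h2
    simp only [map_mul] at h2
    refine ⟨y * iot n t f a (C (∏ j ∈ Finset.univ.erase i, f j ^ a j)) *
      iot n t f a (C (f i ^ k)) + qmap n t f a Polynomial.X * z, ?_⟩
    linear_combination (-qmap n t f a Polynomial.X) * e + y * h2

theorem not_dvd_of_ne (hirr : ∀ i, Irreducible (f i))
    (hcop : ∀ i j, i ≠ j → IsRelPrime (f i) (f j)) {i j : Fin t} (h : i ≠ j) : ¬ f i ∣ f j :=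
  (hirr i).isRelPrime_iff_not_dvd.1 (hcop i j h)

theorem Pid_hasOrd (hirr : ∀ i, Irreducible (f i))
    (hcop : ∀ i j, i ≠ j → IsRelPrime (f i) (f j)) (ha : ∀ i, 1 ≤ a i) (i : Fin t) :
    HasOrd (Pid n t f a i) (iot n t f a (C (f i))) (iot n t f a (X 0)) (a i) := by
  refine ⟨qmap n t f a Polynomial.X, u_not_mem hirr ha i,
    iot n t f a (C (∏ j ∈ Finset.univ.erase i, f j ^ a j)), ?_, ?_⟩
  · rw [iot_mem_Pid ha, constantCoeff_C, (hirr i).prime.dvd_finsetProd_iff]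
    rintro ⟨j, hj, hd⟩
    exact not_dvd_of_ne hirr hcop (Finset.ne_of_mem_erase hj).symm
      ((hirr i).prime.dvd_of_dvd_pow hd)
  · rw [mul_comm, uv_eq, bigF_split i]
    simp only [map_mul, map_pow]

end concrete

/-- **The divisor class group of the hypersurface ring.**
For `A = ℂ[u,v,x₁,…,xₙ]/(uv - f₁^{a₁} ⋯ f_t^{a_t})` with the `fᵢ` irreducible pairwise
coprime polynomials and `aᵢ ≥ 1`, the divisor class group of `A` satisfies
`Cl(A) ≅ ℤ^t / ⟨(a₁, …, a_t)⟩`, the quotient of the free abelian group of rank `t` by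
the subgroup generated by the vector `(a₁, …, a_t)`. -/
theorem hyperRing_classGroup (n t : ℕ) (f : Fin t → MvPolynomial (Fin n) ℂ)
    (hirr : ∀ i, Irreducible (f i)) (hcop : ∀ i j, i ≠ j → IsRelPrime (f i) (f j))
    (a : Fin t → ℕ) (ha : ∀ i, 1 ≤ a i) :
    Nonempty (ClassGrp (HyperRing n t f a) ≃+
        ((Fin t → ℤ) ⧸ AddSubgroup.zmultiples fun i : Fin t => (a i : ℤ))) := by
  have hprime := defEq_prime n t f a hirr
  have hI : (hyperIdeal n t f a).IsPrime :=
    (Ideal.span_singleton_prime hprime.ne_zero).2 hprime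
  have hdom : IsDomain (HyperRing n t f a) := Ideal.Quotient.isDomain _
  refine nagata_abstract (nagSetup n t f a) (Pid n t f a) (Pid_prime hirr ha)
    (fun i => iot n t f a (C (f i))) a (Pid_unif hirr ha) ?_ ?_ ?_ (Pid_hasOrd hirr hcop ha)
  · intro i
    rw [iot_mem_Pid ha]
    simp
  · intro Q hQ hv
    have h1 : iot n t f a (C (bigF n t f a)) ∈ Q := by
      rw [← uv_eq]
      exact Q.mul_mem_right _ hv
    rw [bigF, map_prod, map_prod, hQ.prod_mem_iff] at h1
    obtain ⟨i, -, hi⟩ := h1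
    rw [map_pow, map_pow] at hi
    exact ⟨i, Pid_le i Q hv (hQ.mem_of_pow_mem _ hi)⟩
  · intro i j hij
    by_contra hne
    have h1 := hij (Pid_unif hirr ha i).mem
    rw [iot_mem_Pid ha, constantCoeff_C] at h1
    exact not_dvd_of_ne hirr hcop (Ne.symm hne) h1
end

section
/- Let A be a 2-dimensional ring of the form ℂ[u,v,x]/(uv − f_1^{a_1}···f_t^{a_t}) with f_i ∈ ℂ[x] irreducible pairwise coprime and a_i ≥ 1. Then G_0(A) ≅ ℤ ⊕ Cl(A), where the ℤ-summand is given by the rank map. -/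
universe u v

/-! ### The Grothendieck group `G₀` of finitely generated modules -/

/-- A bundled finitely generated module over the commutative ring `R`. -/
structure FGMod (R : Type u) [CommRing R] : Type (u + 1) where
  carrier : Type u
  [isAddCommGroup : AddCommGroup carrier]
  [isModule : Module R carrier]
  [isFinite : Module.Finite R carrier]

attribute [instance] FGMod.isAddCommGroup FGMod.isModule FGMod.isFinite

/-- The bundled finitely generated module attached to a module. -/
def FGMod.of (R : Type u) [CommRing R] (M : Type u) [AddCommGroup M] [Module R M]
    [Module.Finite R M] : FGMod R :=
  ⟨M⟩

/-- The subgroup of relations coming from short exact sequences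
`0 → A → B → C → 0` of finitely generated `R`-modules. -/
def G0Rels (R : Type u) [CommRing R] : AddSubgroup (FreeAbelianGroup (FGMod R)) :=
  AddSubgroup.closure
    { x | ∃ (A B C : FGMod R) (f : A.carrier →ₗ[R] B.carrier) (g : B.carrier →ₗ[R] C.carrier),
        Function.Injective f ∧ Function.Surjective g ∧ LinearMap.range f = LinearMap.ker g ∧
        x = FreeAbelianGroup.of B - FreeAbelianGroup.of A - FreeAbelianGroup.of C }

/-- The Grothendieck group `G₀(R) = K₀(mod R)` of finitely generated `R`-modules:
the free abelian group on (finitely generated) modules modulo the relation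
`[B] = [A] + [C]` for every short exact sequence `0 → A → B → C → 0`. -/
def G0 (R : Type u) [CommRing R] : Type (u + 1) :=
  FreeAbelianGroup (FGMod R) ⧸ G0Rels R

noncomputable instance (R : Type u) [CommRing R] : AddCommGroup (G0 R) :=
  inferInstanceAs (AddCommGroup (FreeAbelianGroup (FGMod R) ⧸ G0Rels R))

/-- The class `[M]` of a finitely generated module in the Grothendieck group `G₀(R)`. -/
def G0.mk {R : Type u} [CommRing R] (M : FGMod R) : G0 R :=
  QuotientAddGroup.mk (FreeAbelianGroup.of M)

/-- In a module over a noetherian ring, every submodule of a finitely generated module is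
finitely generated. -/
instance (R : Type u) [CommRing R] [IsNoetherianRing R] (M : Type u) [AddCommGroup M]
    [Module R M] [Module.Finite R M] (N : Submodule R M) : Module.Finite R ↥N := by
  haveI : IsNoetherian R M := isNoetherian_of_isNoetherianRing_of_finite R M
  exact Module.Finite.iff_fg.mpr (IsNoetherian.noetherian N)

open MvPolynomial

section GeneralPart

/-- Length of the cokernel of an injective endomorphism of a free module over a PID. -/
lemma length_coker_det {S : Type u} [CommRing S] [IsDomain S] [IsPrincipalIdealRing S]
    {F : Type v} [AddCommGroup F] [Module S F] [Module.Free S F] [Module.Finite S F]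
    (θ : F →ₗ[S] F) (hθ : Function.Injective θ) :
    Module.length S (F ⧸ LinearMap.range θ) = Ring.ord S (LinearMap.det θ) := by
  classical
  let b := Module.Free.chooseBasis S F
  have hr : Module.finrank S (LinearMap.range θ) = Module.finrank S F :=
    LinearMap.finrank_range_of_inj hθ
  obtain ⟨b', a, ab', hab⟩ := Submodule.exists_smith_normal_form_of_rank_eq b hr
  have ha : ∀ i, a i ≠ 0 := by
    intro i hi
    apply ab'.ne_zero i
    apply Subtype.ext
    rw [hab, hi]; simp
  let h : F ≃ₗ[S] F := (b'.equiv ab' (Equiv.refl _)).trans (LinearEquiv.ofInjective θ hθ).symm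
  have hcomp : ∀ i, θ (h (b' i)) = a i • b' i := by
    intro i
    rw [← hab i]
    have : (LinearEquiv.ofInjective θ hθ) (h (b' i)) = ab' i := by
      simp [h]
    rw [← this]; rfl
  have hdet : LinearMap.det θ * LinearMap.det (h : F →ₗ[S] F) = ∏ i, a i := by
    rw [← LinearMap.det_comp]
    rw [← LinearMap.det_toMatrix b']
    have : LinearMap.toMatrix b' b' (θ ∘ₗ (h : F →ₗ[S] F)) = Matrix.diagonal a := by
      ext i j
      rw [LinearMap.toMatrix_apply]
      simp only [LinearMap.comp_apply, LinearEquiv.coe_coe, hcomp]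
      simp [Matrix.diagonal_apply, Finsupp.single_apply]
      grind
    rw [this, Matrix.det_diagonal]
  have hassoc : Associated (LinearMap.det θ) (∏ i, a i) := by
    rw [← hdet]
    exact (associated_mul_unit_right _ _ (LinearEquiv.isUnit_det' h))
  rw [Ring.ord_eq_of_associated hassoc]
  have hprod : ∀ s : Finset (Module.Free.ChooseBasisIndex S F),
      Ring.ord S (∏ i ∈ s, a i) = ∑ i ∈ s, Ring.ord S (a i) := by
    intro s
    induction s using Finset.induction_on with
    | empty => simp
    | insert i s hi ih =>
      rw [Finset.prod_insert hi, Finset.sum_insert hi, Ring.ord_mul, ih]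
      exact mem_nonZeroDivisors_of_ne_zero (Finset.prod_ne_zero_iff.mpr fun i _ => ha i)
  rw [hprod]
  let π : F →ₗ[S] (∀ i, S ⧸ Ideal.span {a i}) :=
    LinearMap.pi fun i => (Submodule.mkQ (Ideal.span {a i})) ∘ₗ b'.coord i
  have hπ : Function.Surjective π := by
    intro y
    choose z hz using fun i => Submodule.mkQ_surjective (Ideal.span {a i}) (y i)
    refine ⟨∑ i, z i • b' i, ?_⟩
    funext i
    simp only [π, LinearMap.pi_apply, LinearMap.comp_apply]
    rw [← hz i]
    congr 1
    simp [Finsupp.single_apply]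
  have hker : LinearMap.range θ = LinearMap.ker π := by
    ext x
    constructor
    · intro hx
      have hx' := congrArg (Subtype.val) (ab'.sum_repr ⟨x, hx⟩)
      simp only [Submodule.coe_sum, Submodule.coe_smul, hab] at hx'
      rw [LinearMap.mem_ker, ← hx']
      simp only [map_sum, map_smul]
      refine Finset.sum_eq_zero fun i _ => ?_
      have : a i • π (b' i) = 0 := by
        funext j
        rw [← map_smul]
        simp only [π, LinearMap.pi_apply, LinearMap.comp_apply, Pi.zero_apply]
        rw [Submodule.mkQ_apply, Submodule.Quotient.mk_eq_zero, Ideal.mem_span_singleton]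
        simp only [map_smul, Module.Basis.coord_apply, Module.Basis.repr_self, Finsupp.single_apply]
        split_ifs with hij
        · subst hij; simp
        · simp
      rw [this, smul_zero]
    · intro hx
      have h1 : ∀ i, a i ∣ b'.repr x i := by
        intro i
        have := congrFun (LinearMap.mem_ker.mp hx) i
        simp only [π, LinearMap.pi_apply, LinearMap.comp_apply, Pi.zero_apply] at this
        rwa [Submodule.mkQ_apply, Submodule.Quotient.mk_eq_zero, Ideal.mem_span_singleton] at this
      choose c hc using h1
      rw [← b'.sum_repr x]
      refine Submodule.sum_mem _ fun i _ => ?_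
      rw [hc, mul_comm, mul_smul, ← hab]
      exact Submodule.smul_mem _ _ (ab' i).2
  rw [((Submodule.quotEquivOfEq _ _ hker).trans
    (LinearMap.quotKerEquivOfSurjective π hπ)).length_eq, Module.length_pi_of_fintype]
  rfl

lemma det_ne_zero_of_inj {S : Type u} [CommRing S] [IsDomain S]
    {F : Type v} [AddCommGroup F] [Module S F] [Module.Free S F] [Module.Finite S F]
    (θ : F →ₗ[S] F) (hθ : Function.Injective θ) : LinearMap.det θ ≠ 0 := by
  classical
  let b := Module.Free.chooseBasis S F
  rw [← LinearMap.det_toMatrix b]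
  intro h0
  obtain ⟨w, hw, hw0⟩ := Matrix.exists_mulVec_eq_zero_iff.mpr h0
  apply hw
  have h1 : θ (b.equivFun.symm w) = 0 := by
    apply b.equivFun.injective
    rw [map_zero, ← hw0]
    have := LinearMap.toMatrix_mulVec_repr b b θ (b.equivFun.symm w)
    rw [Module.Basis.equivFun_apply, ← this]
    congr 1
    exact (b.equivFun_apply _).symm.trans (b.equivFun.apply_symm_apply w)
  have h2 := hθ (h1.trans (map_zero θ).symm)
  exact (LinearEquiv.map_eq_zero_iff _).mp h2

lemma det_smul_mem_range {S : Type u} [CommRing S]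
    {F : Type v} [AddCommGroup F] [Module S F] [Module.Free S F] [Module.Finite S F]
    (θ : F →ₗ[S] F) (y : F) : LinearMap.det θ • y ∈ LinearMap.range θ := by
  classical
  let b := Module.Free.chooseBasis S F
  let M := LinearMap.toMatrix b b θ
  refine ⟨Matrix.toLin b b M.adjugate y, ?_⟩
  have h1 : θ = Matrix.toLin b b M := (Matrix.toLin_toMatrix b b θ).symm
  conv_lhs => rw [h1]
  rw [← LinearMap.comp_apply, ← Matrix.toLin_mul, Matrix.mul_adjugate, LinearMap.det_toMatrix]
  simp


open TensorProduct in
/-- The length of `M` at the prime `p`. -/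
noncomputable def locLen (R : Type u) [CommRing R] (p : ↥(heightOnePrimes R))
    (M : Type u) [AddCommGroup M] [Module R M] : ℕ∞ :=
  Module.length (Localization.AtPrime p.1.asIdeal) (Localization.AtPrime p.1.asIdeal ⊗[R] M)

variable {R : Type u} [CommRing R]

lemma locLen_exact (p : ↥(heightOnePrimes R)) {M₁ M₂ M₃ : Type u}
    [AddCommGroup M₁] [Module R M₁] [AddCommGroup M₂] [Module R M₂] [AddCommGroup M₃] [Module R M₃]
    (f : M₁ →ₗ[R] M₂) (g : M₂ →ₗ[R] M₃) (hf : Function.Injective f) (hg : Function.Surjective g)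
    (hfg : Function.Exact f g) : locLen R p M₂ = locLen R p M₁ + locLen R p M₃ := by
  have : Module.Flat R (Localization.AtPrime p.1.asIdeal) :=
    IsLocalization.flat _ p.1.asIdeal.primeCompl
  refine Module.length_eq_add_of_exact (f.baseChange (Localization.AtPrime p.1.asIdeal))
    (g.baseChange (Localization.AtPrime p.1.asIdeal)) ?_ ?_ ?_
  · rw [LinearMap.baseChange_eq_ltensor]
    exact Module.Flat.lTensor_preserves_injective_linearMap f hf
  · rw [LinearMap.baseChange_eq_ltensor]
    exact LinearMap.lTensor_surjective _ hg
  · rw [LinearMap.baseChange_eq_ltensor, LinearMap.baseChange_eq_ltensor]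
    exact Module.Flat.lTensor_exact _ hfg

lemma locLen_equiv (p : ↥(heightOnePrimes R)) {M₁ M₂ : Type u}
    [AddCommGroup M₁] [Module R M₁] [AddCommGroup M₂] [Module R M₂]
    (e : M₁ ≃ₗ[R] M₂) : locLen R p M₁ = locLen R p M₂ :=
  (e.baseChange R (Localization.AtPrime p.1.asIdeal) _ _).length_eq

lemma locLen_zero (p : ↥(heightOnePrimes R)) {M : Type u}
    [AddCommGroup M] [Module R M] [Subsingleton M] : locLen R p M = 0 := by
  unfold locLen
  exact Module.length_eq_zero

lemma height_one_eq [IsDomain R] (p : ↥(heightOnePrimes R)) (q : Ideal R) [q.IsPrime] (hq : q ≠ ⊥)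
    (hle : q ≤ p.1.asIdeal) : q = p.1.asIdeal := by
  by_contra hne
  let q' : PrimeSpectrum R := ⟨q, inferInstance⟩
  have hlt : q' < p.1 := lt_of_le_of_ne hle (fun h => hne (by rw [← h]))
  have h0 : (⊥ : PrimeSpectrum R) < q' := bot_lt_iff_ne_bot.mpr (fun h => hq (by
    have := congrArg PrimeSpectrum.asIdeal h
    simpa [q'] using this))
  have h1 : Order.height p.1 = 1 := p.2
  have h2 := Order.height_add_one_le hlt
  have h3 := Order.height_add_one_le h0
  rw [h1] at h2
  have h4 : (1 : ℕ∞) ≤ Order.height q' := le_trans (by simp) h3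
  have h5 : (1 : ℕ∞) + 1 ≤ 1 := le_trans (by gcongr) h2
  revert h5
  decide

lemma locLen_quot_self (p : ↥(heightOnePrimes R)) : locLen R p (R ⧸ p.1.asIdeal) = 1 := by
  unfold locLen
  have e := Algebra.TensorProduct.tensorQuotientEquiv (R := R) (Localization.AtPrime p.1.asIdeal) R
    (Localization.AtPrime p.1.asIdeal) p.1.asIdeal
  rw [e.toLinearEquiv.length_eq]
  have e2 : (TensorProduct R (Localization.AtPrime p.1.asIdeal) R ⧸
      Ideal.map (Algebra.TensorProduct.includeRight : R →ₐ[R]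
        TensorProduct R (Localization.AtPrime p.1.asIdeal) R) p.1.asIdeal) ≃ₐ[Localization.AtPrime p.1.asIdeal]
      (Localization.AtPrime p.1.asIdeal ⧸
        IsLocalRing.maximalIdeal (Localization.AtPrime p.1.asIdeal)) := by
    refine Ideal.quotientEquivAlg _ _ (Algebra.TensorProduct.rid R _ _) ?_
    rw [Ideal.map_coe, ← Localization.AtPrime.map_eq_maximalIdeal]
    rw [← Ideal.map_coe (Algebra.TensorProduct.includeRight),
      ← Ideal.map_coe (Algebra.TensorProduct.rid R _ _), Ideal.map_map]
    congr 1
    ext x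
    simp [Algebra.smul_def]
  rw [e2.toLinearEquiv.length_eq]
  rw [Module.length_eq_one_iff]
  exact isSimpleModule_iff_isCoatom.mpr (IsLocalRing.maximalIdeal.isMaximal _).out

lemma locLen_of_smul (p : ↥(heightOnePrimes R)) {M : Type u}
    [AddCommGroup M] [Module R M] (s : R) (hs : s ∉ p.1.asIdeal) (h : ∀ m : M, s • m = 0) :
    locLen R p M = 0 := by
  unfold locLen
  rw [Module.length_eq_zero_iff]
  refine subsingleton_of_forall_eq 0 fun x => ?_
  have hu : IsUnit (algebraMap R (Localization.AtPrime p.1.asIdeal) s) :=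
    IsLocalization.map_units _ (⟨s, hs⟩ : p.1.asIdeal.primeCompl)
  obtain ⟨w, hw⟩ := hu
  induction x with
  | zero => rfl
  | add x y hx hy => rw [hx, hy, add_zero]
  | tmul a m =>
    have : a = s • ((↑w⁻¹ : Localization.AtPrime p.1.asIdeal) * a) := by
      rw [Algebra.smul_def, ← hw, ← mul_assoc]; simp
    rw [this, TensorProduct.smul_tmul, h, TensorProduct.tmul_zero]

lemma locLen_quot_ne [IsDomain R] (p : ↥(heightOnePrimes R)) (q : Ideal R) [q.IsPrime] (hq : q ≠ ⊥)
    (hne : q ≠ p.1.asIdeal) : locLen R p (R ⧸ q) = 0 := by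
  have : ¬ q ≤ p.1.asIdeal := fun h => hne (height_one_eq p q hq h)
  obtain ⟨s, hs, hsp⟩ := SetLike.not_le_iff_exists.mp this
  refine locLen_of_smul p s hsp fun m => ?_
  obtain ⟨x, rfl⟩ := Ideal.Quotient.mk_surjective m
  rw [Algebra.smul_def, Ideal.Quotient.algebraMap_eq, ← map_mul, Ideal.Quotient.eq_zero_iff_mem]
  exact q.mul_mem_right _ hs

/-- Killed by a nonzero element. -/
def Tors (R : Type u) [CommRing R] (M : Type u) [AddCommGroup M] [Module R M] : Prop :=
  ∃ s : R, s ≠ 0 ∧ ∀ m : M, s • m = 0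

lemma Tors.of_inj {M N : Type u} [AddCommGroup M] [Module R M] [AddCommGroup N] [Module R N]
    (h : Tors R N) (f : M →ₗ[R] N) (hf : Function.Injective f) : Tors R M := by
  obtain ⟨s, h0, hs⟩ := h
  exact ⟨s, h0, fun m => hf (by rw [map_smul, hs, map_zero])⟩

lemma Tors.of_surj {M N : Type u} [AddCommGroup M] [Module R M] [AddCommGroup N] [Module R N]
    (h : Tors R M) (f : M →ₗ[R] N) (hf : Function.Surjective f) : Tors R N := by
  obtain ⟨s, h0, hs⟩ := h
  refine ⟨s, h0, fun m => ?_⟩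
  obtain ⟨x, rfl⟩ := hf m
  rw [← map_smul, hs, map_zero]

lemma Tors.of_exact [IsDomain R] {M₁ M₂ M₃ : Type u}
    [AddCommGroup M₁] [Module R M₁] [AddCommGroup M₂] [Module R M₂] [AddCommGroup M₃] [Module R M₃]
    (f : M₁ →ₗ[R] M₂) (g : M₂ →ₗ[R] M₃) (hfg : Function.Exact f g)
    (h1 : Tors R M₁) (h3 : Tors R M₃) : Tors R M₂ := by
  obtain ⟨s, h0, hs⟩ := h1
  obtain ⟨t, ht0, ht⟩ := h3
  refine ⟨s * t, mul_ne_zero h0 ht0, fun m => ?_⟩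
  obtain ⟨y, hy⟩ := (hfg (t • m)).mp (by rw [map_smul, ht])
  rw [mul_smul, ← hy, ← map_smul, hs, map_zero]

/-- `D` is the divisor of `M`. -/
def IsDiv (R : Type u) [CommRing R] (M : Type u) [AddCommGroup M] [Module R M]
    (D : ↥(heightOnePrimes R) →₀ ℕ) : Prop :=
  ∀ p, locLen R p M = D p

/-! ### Basic facts on G0 -/

lemma G0.mk_exact (M₁ M₂ M₃ : Type u)
    [AddCommGroup M₁] [Module R M₁] [Module.Finite R M₁] [AddCommGroup M₂] [Module R M₂]
    [Module.Finite R M₂] [AddCommGroup M₃] [Module R M₃] [Module.Finite R M₃]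
    (f : M₁ →ₗ[R] M₂) (g : M₂ →ₗ[R] M₃) (hf : Function.Injective f) (hg : Function.Surjective g)
    (hfg : Function.Exact f g) :
    G0.mk (FGMod.of R M₂) = G0.mk (FGMod.of R M₁) + G0.mk (FGMod.of R M₃) := by
  have h : FreeAbelianGroup.of (FGMod.of R M₂) - FreeAbelianGroup.of (FGMod.of R M₁)
      - FreeAbelianGroup.of (FGMod.of R M₃) ∈ G0Rels R :=
    AddSubgroup.subset_closure ⟨FGMod.of R M₁, FGMod.of R M₂, FGMod.of R M₃, f, g, hf, hg,
      (LinearMap.exact_iff.mp hfg).symm, rfl⟩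
  have h2 := (QuotientAddGroup.eq_zero_iff _).mpr h
  have h3 : G0.mk (FGMod.of R M₂) - G0.mk (FGMod.of R M₁) - G0.mk (FGMod.of R M₃) = 0 := h2
  rw [sub_sub, sub_eq_zero] at h3
  exact h3

lemma G0.mk_zero (M : Type u) [AddCommGroup M] [Module R M] [Module.Finite R M]
    [Subsingleton M] : G0.mk (FGMod.of R M) = 0 := by
  have := G0.mk_exact M M M (LinearMap.id : M →ₗ[R] M) (LinearMap.id : M →ₗ[R] M)
    (fun _ _ h => h) (fun x => ⟨x, rfl⟩) (fun x => by
      constructor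
      · intro _; exact ⟨x, rfl⟩
      · intro _; exact Subsingleton.elim _ _)
  exact left_eq_add.mp this

lemma G0.mk_equiv (M N : Type u) [AddCommGroup M] [Module R M] [Module.Finite R M]
    [AddCommGroup N] [Module R N] [Module.Finite R N] (e : M ≃ₗ[R] N) :
    G0.mk (FGMod.of R M) = G0.mk (FGMod.of R N) := by
  have := G0.mk_exact M N PUnit.{u+1} (e : M →ₗ[R] N) (0 : N →ₗ[R] PUnit.{u+1}) e.injective
    (Function.surjective_to_subsingleton _) ((e.exact_zero_iff_surjective _).2 e.surjective)
  rw [this, G0.mk_zero PUnit.{u+1}, add_zero]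

/-- The class of `R ⧸ p`. -/
noncomputable def clsP (p : ↥(heightOnePrimes R)) : G0 R :=
  G0.mk (FGMod.of R (R ⧸ p.1.asIdeal))

/-- divisors to `G0` -/
noncomputable def divToG0 (R : Type u) [CommRing R] : DivisorGroup R →+ G0 R :=
  Finsupp.liftAddHom fun p => (zmultiplesHom (G0 R)) (clsP p)

/-- natural divisors to integer divisors -/
noncomputable def toDiv (D : ↥(heightOnePrimes R) →₀ ℕ) : DivisorGroup R :=
  D.mapRange (fun n : ℕ => (n : ℤ)) rfl

lemma toDiv_apply (D : ↥(heightOnePrimes R) →₀ ℕ) (p) : toDiv D p = (D p : ℤ) := by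
  simp [toDiv]

lemma toDiv_add (D E : ↥(heightOnePrimes R) →₀ ℕ) : toDiv (D + E) = toDiv D + toDiv E := by
  ext p
  simp [toDiv_apply]

lemma IsDiv.unique {M : Type u} [AddCommGroup M] [Module R M] {D E : ↥(heightOnePrimes R) →₀ ℕ}
    (h1 : IsDiv R M D) (h2 : IsDiv R M E) : D = E := by
  ext p
  have := (h1 p).symm.trans (h2 p)
  exact_mod_cast this

lemma IsDiv.exact {M₁ M₂ M₃ : Type u}
    [AddCommGroup M₁] [Module R M₁] [AddCommGroup M₂] [Module R M₂] [AddCommGroup M₃] [Module R M₃]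
    (f : M₁ →ₗ[R] M₂) (g : M₂ →ₗ[R] M₃) (hf : Function.Injective f) (hg : Function.Surjective g)
    (hfg : Function.Exact f g) {D E : ↥(heightOnePrimes R) →₀ ℕ}
    (h1 : IsDiv R M₁ D) (h2 : IsDiv R M₃ E) : IsDiv R M₂ (D + E) := by
  intro p
  rw [locLen_exact p f g hf hg hfg, h1 p, h2 p]
  simp

lemma isDiv_quot_prime [IsDomain R] (p : ↥(heightOnePrimes R)) :
    IsDiv R (R ⧸ p.1.asIdeal) (Finsupp.single p 1) := by
  classical
  intro q
  rw [Finsupp.single_apply]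
  split_ifs with h
  · subst h; rw [locLen_quot_self]; rfl
  · have hp : p.1.asIdeal ≠ ⊥ := by
      intro h0
      have h1 : Order.height p.1 = 1 := p.2
      have : p.1 = ⊥ := PrimeSpectrum.ext h0
      rw [this, Order.height_bot] at h1
      exact zero_ne_one h1
    rw [locLen_quot_ne q _ hp (fun h' => h (Subtype.ext (PrimeSpectrum.ext h')))]; rfl

/-- Every torsion module has a divisor. -/
lemma exists_isDiv [IsDomain R] [IsNoetherianRing R]
    (hk : ∀ q : PrimeSpectrum R, q ≠ ⊥ → Order.height q ≠ 1 →
      G0.mk (FGMod.of R (R ⧸ q.asIdeal)) = 0)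
    (M : Type u) [AddCommGroup M] [Module R M] [hM : Module.Finite R M] (hT : Tors R M) :
    ∃ D, IsDiv R M D ∧ G0.mk (FGMod.of R M) = divToG0 R (toDiv D) := by
  revert hT
  refine IsNoetherianRing.induction_on_isQuotientEquivQuotientPrime R hM
    (motive := fun N _ _ _ => Tors R N →
      ∃ D, IsDiv R N D ∧ G0.mk (FGMod.of R N) = divToG0 R (toDiv D)) ?_ ?_ ?_
  · intro N _ _ _ _ _
    refine ⟨0, fun p => by simp [locLen_zero], ?_⟩
    rw [G0.mk_zero]
    simp [toDiv]
  · intro N _ _ _ q e hT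
    have hq : q ≠ ⊥ := by
      rintro rfl
      obtain ⟨s, hs, h⟩ := hT.of_surj e.toLinearMap e.surjective
      have := h (Ideal.Quotient.mk _ 1)
      rw [Algebra.smul_def, Ideal.Quotient.algebraMap_eq, ← map_mul,
        Ideal.Quotient.eq_zero_iff_mem] at this
      apply hs
      simpa using this
    rw [G0.mk_equiv N _ e]
    by_cases hh : Order.height q = 1
    · refine ⟨Finsupp.single ⟨q, hh⟩ 1, fun p => ?_, ?_⟩
      · rw [locLen_equiv p e]
        exact isDiv_quot_prime ⟨q, hh⟩ p
      · simp [toDiv, divToG0, clsP]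
    · refine ⟨0, fun p => ?_, ?_⟩
      · rw [locLen_equiv p e]
        rw [locLen_quot_ne p q.1 (fun h => hq (PrimeSpectrum.ext h))]
        · rfl
        · intro h'
          apply hh
          rw [PrimeSpectrum.ext h']
          exact p.2
      · rw [hk q hq hh]; simp [toDiv]
  · intro N₁ _ _ _ N₂ _ _ _ N₃ _ _ _ f g hf hg hfg h1 h3 hT
    obtain ⟨D, hD, hD'⟩ := h1 (hT.of_inj f hf)
    obtain ⟨E, hE, hE'⟩ := h3 (hT.of_surj g hg)
    refine ⟨D + E, hD.exact f g hf hg hfg hE, ?_⟩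
    rw [G0.mk_exact N₁ N₂ N₃ f g hf hg hfg, hD', hE', toDiv_add, map_add]


lemma ordAt_eq_ord [IsDomain R] (p : Ideal R) [p.IsPrime]
    [IsDiscreteValuationRing (Localization.AtPrime p)] (a : R) :
    ordAt R p a = Ring.ord (Localization.AtPrime p) (algebraMap R (Localization.AtPrime p) a) := by
  rw [Ring.ord_eq_addVal]
  unfold ordAt
  obtain ⟨ϖ, hϖ⟩ := IsDiscreteValuationRing.exists_irreducible (Localization.AtPrime p)
  have key : ∀ n : ℕ, algebraMap R (Localization.AtPrime p) a ∈
      Ideal.map (algebraMap R (Localization.AtPrime p)) p ^ n ↔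
      (n : ℕ∞) ≤ IsDiscreteValuationRing.addVal (Localization.AtPrime p)
        (algebraMap R (Localization.AtPrime p) a) := by
    intro n
    rw [Localization.AtPrime.map_eq_maximalIdeal, hϖ.maximalIdeal_eq, Ideal.span_singleton_pow,
      Ideal.mem_span_singleton, ← IsDiscreteValuationRing.addVal_le_iff_dvd]
    simp [IsDiscreteValuationRing.addVal_uniformizer hϖ]
  simp only [Set.mem_ofPred_eq, key]
  generalize IsDiscreteValuationRing.addVal (Localization.AtPrime p)
        (algebraMap R (Localization.AtPrime p) a) = k
  apply le_antisymm
  · exact iSup₂_le fun n hn => hn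
  · induction k using ENat.recTopCoe with
    | top =>
      simp only [le_top, iSup_pos]
      rw [top_le_iff, ENat.iSup_natCast_eq_top]
      rintro ⟨N, hN⟩
      have := hN ⟨N + 1, rfl⟩
      simp at this
    | coe k => exact le_iSup₂_of_le k le_rfl le_rfl

lemma detDiv [IsDomain R]
    (hdvr : ∀ p : ↥(heightOnePrimes R), IsDiscreteValuationRing (Localization.AtPrime p.1.asIdeal))
    {F : Type u} [AddCommGroup F] [Module R F] [Module.Free R F] [Module.Finite R F]
    (θ : F →ₗ[R] F) (hθ : Function.Injective θ) (p : ↥(heightOnePrimes R)) :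
    locLen R p (F ⧸ LinearMap.range θ) = ordAt R p.1.asIdeal (LinearMap.det θ) := by
  have := hdvr p
  rw [ordAt_eq_ord]
  have hfl : Module.Flat R (Localization.AtPrime p.1.asIdeal) :=
    IsLocalization.flat _ p.1.asIdeal.primeCompl
  have h1 : Function.Injective (θ.baseChange (Localization.AtPrime p.1.asIdeal)) := by
    rw [LinearMap.baseChange_eq_ltensor]
    exact Module.Flat.lTensor_preserves_injective_linearMap θ hθ
  rw [← LinearMap.det_baseChange, ← length_coker_det _ h1]
  have h2 : Function.Surjective ((LinearMap.range θ).mkQ.baseChange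
      (Localization.AtPrime p.1.asIdeal)) := by
    rw [LinearMap.baseChange_eq_ltensor]
    exact LinearMap.lTensor_surjective _ (Submodule.mkQ_surjective _)
  have h3 : Function.Exact (θ.baseChange (Localization.AtPrime p.1.asIdeal))
      ((LinearMap.range θ).mkQ.baseChange (Localization.AtPrime p.1.asIdeal)) := by
    rw [LinearMap.baseChange_eq_ltensor, LinearMap.baseChange_eq_ltensor]
    exact Module.Flat.lTensor_exact _ (LinearMap.exact_map_mkQ_range θ)
  unfold locLen
  exact ((Submodule.quotEquivOfEq _ _ (LinearMap.exact_iff.mp h3).symm).trans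
    (LinearMap.quotKerEquivOfSurjective _ h2)).length_eq.symm

lemma coker_comp [IsDomain R] {X Y Z : Type u}
    [AddCommGroup X] [Module R X] [AddCommGroup Y] [Module R Y] [AddCommGroup Z] [Module R Z]
    (α : X →ₗ[R] Y) (β : Y →ₗ[R] Z) (hβ : Function.Injective β)
    {D E : ↥(heightOnePrimes R) →₀ ℕ}
    (tα : Tors R (Y ⧸ LinearMap.range α)) (hD : IsDiv R (Y ⧸ LinearMap.range α) D)
    (tβ : Tors R (Z ⧸ LinearMap.range β)) (hE : IsDiv R (Z ⧸ LinearMap.range β) E) :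
    Tors R (Z ⧸ LinearMap.range (β ∘ₗ α)) ∧ IsDiv R (Z ⧸ LinearMap.range (β ∘ₗ α)) (D + E) := by
  have l1 : LinearMap.range α ≤ (LinearMap.range (β ∘ₗ α)).comap β := by
    rintro _ ⟨x, rfl⟩
    exact ⟨x, rfl⟩
  have l2 : LinearMap.range (β ∘ₗ α) ≤ (LinearMap.range β).comap (LinearMap.id : Z →ₗ[R] Z) := by
    rintro _ ⟨x, rfl⟩
    exact ⟨α x, rfl⟩
  let i := Submodule.mapQ (LinearMap.range α) (LinearMap.range (β ∘ₗ α)) β l1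
  let π := Submodule.mapQ (LinearMap.range (β ∘ₗ α)) (LinearMap.range β) LinearMap.id l2
  have hi : Function.Injective i := by
    rw [injective_iff_map_eq_zero]
    intro y hy
    obtain ⟨y, rfl⟩ := Submodule.mkQ_surjective _ y
    simp only [i, Submodule.mkQ_apply, Submodule.mapQ_apply, Submodule.Quotient.mk_eq_zero] at hy ⊢
    obtain ⟨x, hx⟩ := hy
    exact ⟨x, hβ hx⟩
  have hπ : Function.Surjective π := by
    intro z
    obtain ⟨z, rfl⟩ := Submodule.mkQ_surjective _ z
    exact ⟨Submodule.Quotient.mk z, rfl⟩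
  have hex : Function.Exact i π := by
    intro z
    obtain ⟨z, rfl⟩ := Submodule.mkQ_surjective _ z
    simp only [π, Submodule.mkQ_apply, Submodule.mapQ_apply, Submodule.Quotient.mk_eq_zero,
      LinearMap.id_apply]
    constructor
    · rintro ⟨y, rfl⟩
      exact ⟨Submodule.Quotient.mk y, rfl⟩
    · rintro ⟨y, hy⟩
      obtain ⟨y, rfl⟩ := Submodule.mkQ_surjective _ y
      simp only [i, Submodule.mkQ_apply, Submodule.mapQ_apply] at hy
      obtain ⟨x, hx⟩ := (Submodule.Quotient.eq _).mp hy
      refine ⟨y - α x, ?_⟩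
      rw [map_sub]
      rw [LinearMap.comp_apply] at hx
      rw [hx]; abel
  exact ⟨tα.of_exact i π hex tβ, hD.exact i π hi hπ hex hE⟩

lemma coker_of_exact {X Y C : Type u}
    [AddCommGroup X] [Module R X] [AddCommGroup Y] [Module R Y] [AddCommGroup C] [Module R C]
    (f : X →ₗ[R] Y) (g : Y →ₗ[R] C) (hg : Function.Surjective g) (hfg : Function.Exact f g)
    {D : ↥(heightOnePrimes R) →₀ ℕ} (hT : Tors R C) (hD : IsDiv R C D) :
    Tors R (Y ⧸ LinearMap.range f) ∧ IsDiv R (Y ⧸ LinearMap.range f) D := by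
  let e : (Y ⧸ LinearMap.range f) ≃ₗ[R] C :=
    (Submodule.quotEquivOfEq _ _ (LinearMap.exact_iff.mp hfg).symm).trans
      (LinearMap.quotKerEquivOfSurjective g hg)
  exact ⟨hT.of_inj e.toLinearMap e.injective, fun p => (locLen_equiv p e).trans (hD p)⟩

/-- Projection to the class group. -/
noncomputable def mkCl (R : Type u) [CommRing R] : DivisorGroup R →+ ClassGrp R :=
  QuotientAddGroup.mk' (AddSubgroup.closure (principalDivisors R))

/-- The relation between a module and its (rank, first Chern class). -/
def Cls (R : Type u) [CommRing R] (M : Type u) [AddCommGroup M] [Module R M]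
    (x : ℤ × ClassGrp R) : Prop :=
  ∃ (F : Type u) (_ : AddCommGroup F) (_ : Module R F) (_ : Module.Free R F)
    (_ : Module.Finite R F) (φ : F →ₗ[R] M) (D : ↥(heightOnePrimes R) →₀ ℕ),
    Function.Injective φ ∧ Tors R (M ⧸ LinearMap.range φ) ∧ IsDiv R (M ⧸ LinearMap.range φ) D ∧
    x = ((Module.finrank R F : ℤ), mkCl R (toDiv D))

lemma Tors.zero [IsDomain R] {M : Type u} [AddCommGroup M] [Module R M] [Subsingleton M] :
    Tors R M := ⟨1, one_ne_zero, fun _ => Subsingleton.elim _ _⟩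

lemma Cls.free [IsDomain R] (F : Type u) [AddCommGroup F] [Module R F] [Module.Free R F]
    [Module.Finite R F] : Cls R F ((Module.finrank R F : ℤ), 0) := by
  have h := coker_of_exact (D := 0) (LinearMap.id : F →ₗ[R] F) (0 : F →ₗ[R] PUnit.{u+1})
    (Function.surjective_to_subsingleton _) (fun x => by simp) Tors.zero
    (fun p => by simp [locLen_zero])
  refine ⟨F, inferInstance, inferInstance, inferInstance, inferInstance, LinearMap.id, 0,
    fun _ _ h => h, h.1, h.2, ?_⟩
  simp [toDiv]

lemma Cls.tors [IsDomain R] (M : Type u) [AddCommGroup M] [Module R M] {D}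
    (hT : Tors R M) (hD : IsDiv R M D) : Cls R M (0, mkCl R (toDiv D)) := by
  have h := coker_of_exact (0 : PUnit.{u+1} →ₗ[R] M) (LinearMap.id : M →ₗ[R] M)
    (fun x => ⟨x, rfl⟩) (fun x => by simp [eq_comm]) hT hD
  refine ⟨PUnit.{u+1}, inferInstance, inferInstance, inferInstance, inferInstance, 0, D,
    Function.injective_of_subsingleton _, h.1, h.2, ?_⟩
  rw [Module.finrank_zero_of_subsingleton]
  rfl

lemma Cls.exact [IsDomain R] {M₁ M₂ M₃ : Type u}
    [AddCommGroup M₁] [Module R M₁] [AddCommGroup M₂] [Module R M₂] [AddCommGroup M₃] [Module R M₃]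
    (f : M₁ →ₗ[R] M₂) (g : M₂ →ₗ[R] M₃) (hf : Function.Injective f) (hg : Function.Surjective g)
    (hfg : Function.Exact f g) {x y : ℤ × ClassGrp R}
    (h1 : Cls R M₁ x) (h3 : Cls R M₃ y) : Cls R M₂ (x + y) := by
  obtain ⟨F, _, _, _, _, φ, D, hφ, hT, hD, rfl⟩ := h1
  obtain ⟨G, _, _, _, _, γ, E, hγ, hT', hE, rfl⟩ := h3
  obtain ⟨γ', hγ'⟩ := Module.projective_lifting_property g γ hg
  have hγ'' : ∀ w, g (γ' w) = γ w := fun w => by rw [← hγ']; rfl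
  have hgf : ∀ m, g (f m) = 0 := hfg.apply_apply_eq_zero
  let α : F × G →ₗ[R] M₁ × G := LinearMap.prodMap φ LinearMap.id
  let β : M₁ × G →ₗ[R] M₂ := LinearMap.coprod f γ'
  have hα : Function.Injective α := by
    rintro ⟨a, b⟩ ⟨c, d⟩ h
    simp only [α, LinearMap.prodMap_apply, LinearMap.id_apply, Prod.mk.injEq] at h
    rw [hφ h.1, h.2]
  have hβ : Function.Injective β := by
    rw [injective_iff_map_eq_zero]
    rintro ⟨m, w⟩ h
    simp only [β, LinearMap.coprod_apply] at h
    have hw : w = 0 := by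
      have := congrArg g h
      rw [map_add, hgf, hγ'', zero_add, map_zero] at this
      exact hγ (this.trans (map_zero γ).symm)
    subst hw
    rw [map_zero, add_zero] at h
    rw [hf (h.trans (map_zero f).symm)]; rfl
  have c1 := coker_of_exact α ((LinearMap.range φ).mkQ ∘ₗ LinearMap.fst R M₁ G)
    ((Submodule.mkQ_surjective _).comp LinearMap.fst_surjective) (by
      rintro ⟨m, w⟩
      simp only [LinearMap.comp_apply, LinearMap.fst_apply, Submodule.mkQ_apply,
        Submodule.Quotient.mk_eq_zero]
      constructor
      · rintro ⟨z, rfl⟩; exact ⟨(z, w), rfl⟩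
      · rintro ⟨⟨z, w'⟩, h⟩
        exact ⟨z, congrArg Prod.fst h⟩) hT hD
  have c2 := coker_of_exact β ((LinearMap.range γ).mkQ ∘ₗ g)
    ((Submodule.mkQ_surjective _).comp hg) (by
      intro m
      simp only [LinearMap.comp_apply, Submodule.mkQ_apply,
        Submodule.Quotient.mk_eq_zero]
      constructor
      · rintro ⟨w, hw⟩
        obtain ⟨z, hz⟩ := (hfg (m - γ' w)).mp (by rw [map_sub, hγ'', hw, sub_self])
        exact ⟨(z, w), by simp [β, hz]⟩
      · rintro ⟨⟨z, w⟩, rfl⟩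
        refine ⟨w, ?_⟩
        simp only [β, LinearMap.coprod_apply, map_add, hgf, hγ'', zero_add]) hT' hE
  have c := coker_comp α β hβ c1.1 c1.2 c2.1 c2.2
  refine ⟨F × G, inferInstance, inferInstance, inferInstance, inferInstance, β ∘ₗ α, D + E,
    hβ.comp hα, c.1, c.2, ?_⟩
  simp [Module.finrank_prod, toDiv_add]

lemma Cls.unique_aux [IsDomain R]
    {M : Type u} [AddCommGroup M] [Module R M]
    {F G : Type u} [AddCommGroup F] [Module R F]
    [AddCommGroup G] [Module R G] [Module.Free R G]
    (φ : F →ₗ[R] M) (γ : G →ₗ[R] M) (hγ : Function.Injective γ)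
    (s : R) (hs : s ≠ 0) (h : ∀ m : M ⧸ LinearMap.range φ, s • m = 0) [Module.IsTorsionFree R G] :
    ∃ ψ : G →ₗ[R] F, Function.Injective ψ ∧ φ ∘ₗ ψ = s • γ := by
  have hr : ∀ w, s • γ w ∈ LinearMap.range φ := fun w => by
    have := h (Submodule.Quotient.mk (γ w))
    rwa [← Submodule.Quotient.mk_smul, Submodule.Quotient.mk_eq_zero] at this
  obtain ⟨ψ, hψ⟩ := Module.projective_lifting_property φ.rangeRestrict
    ((s • γ).codRestrict (LinearMap.range φ) hr) (LinearMap.surjective_rangeRestrict φ)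
  have hψ' : φ ∘ₗ ψ = s • γ := by
    ext w
    exact congrArg Subtype.val (LinearMap.congr_fun hψ w)
  refine ⟨ψ, ?_, hψ'⟩
  rw [injective_iff_map_eq_zero]
  intro w hw
  have := LinearMap.congr_fun hψ' w
  rw [LinearMap.comp_apply, hw, map_zero, LinearMap.smul_apply, ← map_smul] at this
  have h2 := hγ (this.symm.trans (map_zero γ).symm)
  exact (smul_eq_zero.mp h2).resolve_left hs

lemma Cls.unique [IsDomain R] [IsNoetherianRing R]
    (hk : ∀ q : PrimeSpectrum R, q ≠ ⊥ → Order.height q ≠ 1 →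
      G0.mk (FGMod.of R (R ⧸ q.asIdeal)) = 0)
    (hdvr : ∀ p : ↥(heightOnePrimes R), IsDiscreteValuationRing (Localization.AtPrime p.1.asIdeal))
    {M : Type u} [AddCommGroup M] [Module R M] {x y : ℤ × ClassGrp R}
    (h1 : Cls R M x) (h2 : Cls R M y) : x = y := by
  obtain ⟨F, _, _, _, _, φ, D, hφ, hT, hD, rfl⟩ := h1
  obtain ⟨G, _, _, _, _, γ, E, hγ, hT', hE, rfl⟩ := h2
  obtain ⟨s, hs, hsm⟩ := id hT
  obtain ⟨s', hs', hsm'⟩ := id hT'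
  obtain ⟨ψ, hψ, hψφ⟩ := Cls.unique_aux φ γ hγ s hs hsm
  obtain ⟨ψ', hψ', -⟩ := Cls.unique_aux γ φ hφ s' hs' hsm'
  have hr : Module.finrank R F = Module.finrank R G :=
    le_antisymm (LinearMap.finrank_le_finrank_of_injective hψ')
      (LinearMap.finrank_le_finrank_of_injective hψ)
  let e : F ≃ₗ[R] G := LinearEquiv.ofFinrankEq F G hr
  let θ : F →ₗ[R] F := ψ ∘ₗ (e : F →ₗ[R] G)
  have hθ : Function.Injective θ := hψ.comp e.injective
  let σ : G →ₗ[R] G := s • LinearMap.id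
  have hσ : Function.Injective σ := by
    rw [injective_iff_map_eq_zero]
    intro w hw
    exact (smul_eq_zero.mp hw).resolve_left hs
  have tθ : Tors R (F ⧸ LinearMap.range θ) := by
    refine ⟨LinearMap.det θ, det_ne_zero_of_inj θ hθ, fun m => ?_⟩
    obtain ⟨m, rfl⟩ := Submodule.mkQ_surjective _ m
    rw [← map_smul, Submodule.mkQ_apply, Submodule.Quotient.mk_eq_zero]
    exact det_smul_mem_range θ m
  have tσ : Tors R (G ⧸ LinearMap.range σ) := by
    refine ⟨LinearMap.det σ, det_ne_zero_of_inj σ hσ, fun m => ?_⟩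
    obtain ⟨m, rfl⟩ := Submodule.mkQ_surjective _ m
    rw [← map_smul, Submodule.mkQ_apply, Submodule.Quotient.mk_eq_zero]
    exact det_smul_mem_range σ m
  obtain ⟨Dθ, hDθ, -⟩ := exists_isDiv hk _ tθ
  obtain ⟨Dσ, hDσ, -⟩ := exists_isDiv hk _ tσ
  have c1 := coker_comp θ φ hφ tθ hDθ hT hD
  have c2 := coker_comp σ γ hγ tσ hDσ hT' hE
  have hrange : LinearMap.range (φ ∘ₗ θ) = LinearMap.range (γ ∘ₗ σ) := by
    have e1 : φ ∘ₗ θ = (γ ∘ₗ σ) ∘ₗ (e : F →ₗ[R] G) := by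
      rw [show φ ∘ₗ θ = (φ ∘ₗ ψ) ∘ₗ (e : F →ₗ[R] G) from rfl, hψφ]
      ext w
      simp [σ]
    rw [e1, LinearMap.range_comp_of_range_eq_top _ e.range]
  rw [hrange] at c1
  have hDE := c1.2.unique c2.2
  refine Prod.ext (by simp [hr]) ?_
  have hmem : toDiv D - toDiv E ∈ AddSubgroup.closure (principalDivisors R) := by
    apply AddSubgroup.subset_closure
    refine ⟨LinearMap.det σ, LinearMap.det θ, det_ne_zero_of_inj σ hσ, det_ne_zero_of_inj θ hθ,
      Dσ, Dθ, fun p => ⟨?_, ?_⟩, fun p => ?_⟩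
    · rw [← detDiv hdvr σ hσ p, hDσ p]
    · rw [← detDiv hdvr θ hθ p, hDθ p]
    · have := DFunLike.congr_fun hDE p
      simp only [Finsupp.add_apply] at this
      simp only [Finsupp.sub_apply, toDiv_apply]
      omega
  have h0 : mkCl R (toDiv D - toDiv E) = 0 := (QuotientAddGroup.eq_zero_iff _).mpr hmem
  rw [map_sub, sub_eq_zero] at h0
  exact h0

lemma Cls.exists [IsDomain R] [IsNoetherianRing R]
    (hk : ∀ q : PrimeSpectrum R, q ≠ ⊥ → Order.height q ≠ 1 →
      G0.mk (FGMod.of R (R ⧸ q.asIdeal)) = 0)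
    (M : Type u) [AddCommGroup M] [Module R M] [hM : Module.Finite R M] :
    ∃ x, Cls R M x := by
  refine IsNoetherianRing.induction_on_isQuotientEquivQuotientPrime R hM
    (motive := fun N _ _ _ => ∃ x, Cls R N x) ?_ ?_ ?_
  · intro N _ _ _ _
    exact ⟨_, Cls.tors N (D := 0) Tors.zero (fun p => by simp [locLen_zero])⟩
  · intro N _ _ _ q e
    by_cases hq : q.1 = ⊥
    · let e' : R ≃ₗ[R] N := ((Submodule.quotEquivOfEqBot _ hq).symm).trans e.symm
      have := Module.Free.of_equiv e'
      exact ⟨_, Cls.free N⟩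
    · obtain ⟨s, hs, hs0⟩ := Submodule.exists_mem_ne_zero_of_ne_bot hq
      have hT : Tors R N := by
        refine ⟨s, hs0, fun m => ?_⟩
        apply e.injective
        rw [map_smul, map_zero]
        obtain ⟨x, hx⟩ := Ideal.Quotient.mk_surjective (e m)
        rw [← hx, Algebra.smul_def, Ideal.Quotient.algebraMap_eq, ← map_mul,
          Ideal.Quotient.eq_zero_iff_mem]
        exact q.1.mul_mem_right _ hs
      obtain ⟨D, hD, -⟩ := exists_isDiv hk N hT
      exact ⟨_, Cls.tors N hT hD⟩
  · rintro N₁ _ _ _ N₂ _ _ _ N₃ _ _ _ f g hf hg hfg ⟨x, hx⟩ ⟨y, hy⟩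
    exact ⟨_, Cls.exact f g hf hg hfg hx hy⟩

theorem g0_general [IsDomain R] [IsNoetherianRing R]
    (hk : ∀ q : PrimeSpectrum R, q ≠ ⊥ → Order.height q ≠ 1 →
      G0.mk (FGMod.of R (R ⧸ q.asIdeal)) = 0)
    (hdvr : ∀ p : ↥(heightOnePrimes R),
      IsDiscreteValuationRing (Localization.AtPrime p.1.asIdeal)) :
    ∃ e : G0 R ≃+ ℤ × ClassGrp R, e (G0.mk (FGMod.of R R)) = (1, 0) := by
  choose c hc using fun M : FGMod R => Cls.exists hk M.carrier
  have huniq : ∀ (M : FGMod R) x, Cls R M.carrier x → c M = x :=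
    fun M x hx => Cls.unique hk hdvr (hc M) hx
  let Φ₀ : FreeAbelianGroup (FGMod R) →+ ℤ × ClassGrp R := FreeAbelianGroup.lift c
  have hΦ₀ : G0Rels R ≤ Φ₀.ker := by
    unfold G0Rels
    rw [AddSubgroup.closure_le]
    rintro x ⟨A, B, C, f, g, hf, hg, hfg, rfl⟩
    have hB : c B = c A + c C :=
      huniq B _ (Cls.exact f g hf hg (LinearMap.exact_iff.mpr hfg.symm) (hc A) (hc C))
    simp only [SetLike.mem_coe, AddMonoidHom.mem_ker, map_sub, Φ₀, FreeAbelianGroup.lift_apply_of]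
    rw [hB]; abel
  let Φ : G0 R →+ ℤ × ClassGrp R := QuotientAddGroup.lift (G0Rels R) Φ₀ hΦ₀
  have hΦ : ∀ M, Φ (G0.mk M) = c M := fun M => by
    change Φ₀ (FreeAbelianGroup.of M) = c M
    simp [Φ₀]
  have hprin : AddSubgroup.closure (principalDivisors R) ≤ (divToG0 R).ker := by
    rw [AddSubgroup.closure_le]
    have key : ∀ (a : R) (va : ↥(heightOnePrimes R) → ℕ), a ≠ 0 →
        (∀ p : ↥(heightOnePrimes R), ordAt R p.1.asIdeal a = va p) →
        ∃ D : ↥(heightOnePrimes R) →₀ ℕ, (∀ p, D p = va p) ∧ divToG0 R (toDiv D) = 0 := by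
      intro a va ha hva
      let σ : R →ₗ[R] R := a • LinearMap.id
      have hσ : Function.Injective σ := by
        rw [injective_iff_map_eq_zero]
        intro w hw
        exact (smul_eq_zero.mp hw).resolve_left ha
      have hdet : LinearMap.det σ = a := by simp [σ]
      have tσ : Tors R (R ⧸ LinearMap.range σ) := by
        refine ⟨LinearMap.det σ, det_ne_zero_of_inj σ hσ, fun m => ?_⟩
        obtain ⟨m, rfl⟩ := Submodule.mkQ_surjective _ m
        rw [← map_smul, Submodule.mkQ_apply, Submodule.Quotient.mk_eq_zero]
        exact det_smul_mem_range σ m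
      obtain ⟨D, hD, hD'⟩ := exists_isDiv hk _ tσ
      refine ⟨D, fun p => ?_, ?_⟩
      · have := hD p
        rw [detDiv hdvr σ hσ p, hdet, hva p] at this
        exact_mod_cast this.symm
      · rw [← hD']
        have := G0.mk_exact R R (R ⧸ LinearMap.range σ) σ (LinearMap.range σ).mkQ hσ
          (Submodule.mkQ_surjective _) (LinearMap.exact_map_mkQ_range σ)
        exact left_eq_add.mp this
    rintro D ⟨a, b, ha, hb, va, vb, hv, hD⟩
    obtain ⟨Da, hDa, hDa'⟩ := key a va ha (fun p => (hv p).1)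
    obtain ⟨Db, hDb, hDb'⟩ := key b vb hb (fun p => (hv p).2)
    have : D = toDiv Da - toDiv Db := by
      ext p
      rw [hD p, Finsupp.sub_apply, toDiv_apply, toDiv_apply, hDa, hDb]
    simp only [SetLike.mem_coe, AddMonoidHom.mem_ker]
    rw [this, map_sub, hDa', hDb', sub_zero]
  let Ψ₀ : ClassGrp R →+ G0 R :=
    QuotientAddGroup.lift (AddSubgroup.closure (principalDivisors R)) (divToG0 R) hprin
  have hΨ₀ : ∀ D, Ψ₀ (mkCl R D) = divToG0 R D := fun D => rfl
  let r : G0 R := G0.mk (FGMod.of R R)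
  have hr : c (FGMod.of R R) = (1, 0) := by
    apply huniq
    have := Cls.free (R := R) R
    rw [Module.finrank_self, Nat.cast_one] at this
    exact this
  let Ψ : ℤ × ClassGrp R →+ G0 R := AddMonoidHom.coprod ((zmultiplesHom (G0 R)) r) Ψ₀
  have hΨ : ∀ n D, Ψ (n, D) = n • r + Ψ₀ D := fun n D => by simp [Ψ]
  -- every element of `G0` of a free module
  have hfree : ∀ (F : Type u) [AddCommGroup F] [Module R F] [Module.Free R F] [Module.Finite R F],
      G0.mk (FGMod.of R F) = (Module.finrank R F : ℤ) • r := by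
    have hn : ∀ n : ℕ, G0.mk (FGMod.of R (Fin n → R)) = (n : ℤ) • r := by
      intro n
      induction n with
      | zero => rw [G0.mk_zero]; simp
      | succ n ih =>
        rw [G0.mk_equiv _ _ (Fin.consLinearEquiv R (fun _ : Fin (n+1) => R)).symm]
        rw [G0.mk_exact R (R × (Fin n → R)) (Fin n → R) (LinearMap.inl R R (Fin n → R))
          (LinearMap.snd R R (Fin n → R)) LinearMap.inl_injective LinearMap.snd_surjective
          Function.Exact.inl_snd, ih]
        push_cast
        rw [add_smul, one_smul, add_comm]
    intro F _ _ _ _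
    rw [G0.mk_equiv F _ (Module.finBasis R F).equivFun, hn]
  have hΨΦ : ∀ x, Ψ (Φ x) = x := by
    have hcomp : (Ψ.comp Φ).comp (QuotientAddGroup.mk' (G0Rels R)) =
        QuotientAddGroup.mk' (G0Rels R) := by
      ext M
      change Ψ (Φ (G0.mk M)) = G0.mk M
      rw [hΦ]
      obtain ⟨F, _, _, _, _, φ, D, hφ, hT, hD, hx⟩ := hc M
      rw [hx, hΨ, hΨ₀]
      obtain ⟨D', hD', hM⟩ := exists_isDiv hk _ hT
      rw [hD.unique hD', ← hM, ← hfree F]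
      exact (G0.mk_exact F M.carrier _ φ (LinearMap.range φ).mkQ hφ
          (Submodule.mkQ_surjective _) (LinearMap.exact_map_mkQ_range φ)).symm
    intro x
    obtain ⟨y, rfl⟩ := QuotientAddGroup.mk'_surjective (G0Rels R) x
    exact DFunLike.congr_fun hcomp y
  have hΦΨ : ∀ x, Φ (Ψ x) = x := by
    have hcl : ∀ D, Φ (divToG0 R D) = (0, mkCl R D) := by
      have : Φ.comp (divToG0 R) = (AddMonoidHom.inr ℤ (ClassGrp R)).comp (mkCl R) := by
        apply Finsupp.addHom_ext'
        intro p
        ext1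
        simp only [divToG0, AddMonoidHom.comp_apply, Finsupp.liftAddHom_apply,
          Finsupp.singleAddHom_apply, AddMonoidHom.inr_apply]
        rw [Finsupp.sum_single_index (by simp)]
        simp only [zmultiplesHom_apply, one_smul]
        rw [clsP, hΦ]
        apply huniq
        have hp : p.1.asIdeal ≠ ⊥ := by
          intro h0
          have h1 : Order.height p.1 = 1 := p.2
          have : p.1 = ⊥ := PrimeSpectrum.ext h0
          rw [this, Order.height_bot] at h1
          exact zero_ne_one h1
        obtain ⟨s, hs, hs0⟩ := Submodule.exists_mem_ne_zero_of_ne_bot hp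
        have hT : Tors R (R ⧸ p.1.asIdeal) := by
          refine ⟨s, hs0, fun m => ?_⟩
          obtain ⟨x, rfl⟩ := Ideal.Quotient.mk_surjective m
          rw [Algebra.smul_def, Ideal.Quotient.algebraMap_eq, ← map_mul,
            Ideal.Quotient.eq_zero_iff_mem]
          exact Ideal.mul_mem_right _ _ hs
        have := Cls.tors _ hT (isDiv_quot_prime p)
        rw [show toDiv (Finsupp.single p 1) = Finsupp.single p 1 by simp [toDiv]] at this
        exact this
      exact fun D => DFunLike.congr_fun this D
    rintro ⟨n, x⟩
    obtain ⟨D, rfl⟩ := QuotientAddGroup.mk'_surjective _ x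
    change Φ (Ψ (n, mkCl R D)) = (n, mkCl R D)
    rw [hΨ, map_add, map_zsmul, hΨ₀, hcl, hΦ, hr]
    simp
  refine ⟨{ Φ with invFun := Ψ, left_inv := hΨΦ, right_inv := hΦΨ }, ?_⟩
  change Φ (G0.mk (FGMod.of R R)) = (1, 0)
  rw [hΦ, hr]

end GeneralPart

section ConcretePart

lemma heightOne_ne_bot {R : Type u} [CommRing R] [IsDomain R] (p : ↥(heightOnePrimes R)) :
    p.1.asIdeal ≠ ⊥ := by
  intro h0
  have h1 : Order.height p.1 = 1 := p.2
  have : p.1 = ⊥ := PrimeSpectrum.ext h0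
  rw [this, Order.height_bot] at h1
  exact zero_ne_one h1

lemma dvr_aux {A : Type u} {B : Type v} [CommRing A] [IsDomain A] [IsNoetherianRing A] [CommRing B]
    [IsDomain B] [UniqueFactorizationMonoid B] (ι : B →+* A) (hι : Function.Injective ι) (w : B)
    (hw : ∀ a, ∃ (n : ℕ) (b : B), ι w ^ n * a = ι b) (p : ↥(heightOnePrimes A))
    (hp : ι w ∉ p.1.asIdeal) : IsDiscreteValuationRing (Localization.AtPrime p.1.asIdeal) := by
  have hpp := p.1.isPrime
  obtain ⟨a, hap, ha0⟩ := Submodule.exists_mem_ne_zero_of_ne_bot (heightOne_ne_bot p)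
  have hw0 : ι w ≠ 0 := fun h => hp (h ▸ Ideal.zero_mem _)
  have hq : (p.1.asIdeal.comap ι) ≠ ⊥ := by
    obtain ⟨n, b, hb⟩ := hw a
    intro h
    have hbm : b ∈ p.1.asIdeal.comap ι := by
      rw [Ideal.mem_comap, ← hb]
      exact Ideal.mul_mem_left _ _ hap
    rw [h, Ideal.mem_bot] at hbm
    rw [hbm, map_zero] at hb
    exact mul_ne_zero (pow_ne_zero _ hw0) ha0 hb
  obtain ⟨ϖ, hϖq, hϖ⟩ := Ideal.IsPrime.exists_mem_prime_of_ne_bot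
    (Ideal.IsPrime.comap ι (K := p.1.asIdeal)) hq
  have hϖp : ι ϖ ∈ p.1.asIdeal := hϖq
  have hϖw : ¬ ϖ ∣ w := by
    rintro ⟨c, rfl⟩
    rw [map_mul] at hp
    exact hp (Ideal.mul_mem_right _ _ hϖp)
  let P0 : Ideal A :=
    { carrier := {a | ∃ (n : ℕ) (b : B), ι w ^ n * a = ι (ϖ * b)}
      zero_mem' := ⟨0, 0, by simp⟩
      add_mem' := by
        rintro a a' ⟨n, b, h⟩ ⟨m, b', h'⟩
        refine ⟨n + m, w ^ m * b + w ^ n * b', ?_⟩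
        have : ι w ^ (n + m) * (a + a') =
          ι w ^ m * (ι w ^ n * a) + ι w ^ n * (ι w ^ m * a') := by ring
        rw [this, h, h']
        simp only [map_mul, map_add, map_pow]
        ring
      smul_mem' := by
        rintro c a ⟨n, b, h⟩
        obtain ⟨m, d, hd⟩ := hw c
        refine ⟨n + m, b * d, ?_⟩
        have : ι w ^ (n + m) * (c • a) = (ι w ^ m * c) * (ι w ^ n * a) := by
          rw [smul_eq_mul]; ring
        rw [this, h, hd]
        simp only [map_mul]
        ring }
  have hP0 : ∀ a, a ∈ P0 ↔ ∃ (n : ℕ) (b : B), ι w ^ n * a = ι (ϖ * b) := fun a => Iff.rfl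
  have hle : P0 ≤ p.1.asIdeal := by
    rintro a ⟨n, b, h⟩
    have h1 : ι w ^ n * a ∈ p.1.asIdeal := by
      rw [h, map_mul]
      exact Ideal.mul_mem_right _ _ hϖp
    exact (hpp.mem_or_mem h1).resolve_left fun h2 => hp (hpp.mem_of_pow_mem _ h2)
  have hP0p : P0.IsPrime := by
    constructor
    · intro h
      rw [h, top_le_iff] at hle
      exact hpp.ne_top hle
    · intro x y hxy
      obtain ⟨k, d, hk⟩ := hxy
      obtain ⟨n, b, hb⟩ := hw x
      obtain ⟨m, c, hc⟩ := hw y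
      have h1 : ι (w ^ k * (b * c)) = ι (ϖ * (w ^ (n + m) * d)) := by
        have e1 : ι (w ^ k * (b * c)) = ι w ^ k * (ι b * ι c) := by simp
        have e2 : ι (ϖ * (w ^ (n + m) * d)) = ι w ^ (n + m) * ι (ϖ * d) := by
          simp only [map_mul, map_pow]; ring
        rw [e1, e2, ← hb, ← hc, ← hk]; ring
      have h2 : ϖ ∣ w ^ k * (b * c) := ⟨_, hι h1⟩
      rcases hϖ.dvd_or_dvd h2 with h3 | h3
      · exact absurd (hϖ.dvd_of_dvd_pow h3) hϖw
      · rcases hϖ.dvd_or_dvd h3 with ⟨e, rfl⟩ | ⟨e, rfl⟩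
        · exact Or.inl ⟨n, e, hb⟩
        · exact Or.inr ⟨m, e, hc⟩
  have hP0b : P0 ≠ ⊥ := by
    intro h
    have : ι ϖ ∈ P0 := ⟨0, 1, by simp⟩
    rw [h, Ideal.mem_bot] at this
    exact hϖ.ne_zero (hι (this.trans (map_zero ι).symm))
  have hEq := height_one_eq p P0 hP0b hle
  let S := Localization.AtPrime p.1.asIdeal
  have hmax : IsLocalRing.maximalIdeal S = Ideal.span {algebraMap A S (ι ϖ)} := by
    rw [← Localization.AtPrime.map_eq_maximalIdeal]
    apply le_antisymm
    · rw [Ideal.map_le_iff_le_comap]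
      intro c hc
      rw [← hEq] at hc
      obtain ⟨n, b, h⟩ := hc
      rw [Ideal.mem_comap, Ideal.mem_span_singleton]
      have hu : IsUnit (algebraMap A S (ι w ^ n)) :=
        IsLocalization.map_units S (⟨ι w ^ n, fun h2 => hp (hpp.mem_of_pow_mem _ h2)⟩ :
          p.1.asIdeal.primeCompl)
      rw [← hu.dvd_mul_left, ← map_mul, h, map_mul, map_mul]
      exact dvd_mul_right _ _
    · rw [Ideal.span_singleton_le_iff_mem]
      exact Ideal.mem_map_of_mem _ hϖp
  have hnf : ¬ IsField S := by
    rw [IsLocalRing.isField_iff_maximalIdeal_eq]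
    intro h
    have h1 : algebraMap A S (ι ϖ) ∈ IsLocalRing.maximalIdeal S := by
      rw [hmax]; exact Ideal.mem_span_singleton_self _
    rw [h, Ideal.mem_bot] at h1
    have h2 := (IsLocalization.injective S p.1.asIdeal.primeCompl_le_nonZeroDivisors)
      (h1.trans (map_zero _).symm)
    exact hϖ.ne_zero (hι (h2.trans (map_zero ι).symm))
  have hN : IsNoetherianRing S := IsLocalization.isNoetherianRing p.1.asIdeal.primeCompl S inferInstance
  have hpr : Submodule.IsPrincipal (IsLocalRing.maximalIdeal S) := ⟨⟨_, hmax⟩⟩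
  have hiff : IsDiscreteValuationRing S ↔ Submodule.IsPrincipal (IsLocalRing.maximalIdeal S) :=
    (IsDiscreteValuationRing.TFAE S hnf).out 0 4
  exact hiff.mpr hpr

/-- Abstract properties of the ring `ℂ[u,v,x]/(uv - P(x))`. -/
structure HS (A : Type) [CommRing A] [Algebra ℂ A] (u v x : A) (P : Polynomial ℂ) : Prop where
  rel : u * v = Polynomial.aeval x P
  ne : P ≠ 0
  gen : Algebra.adjoin ℂ {u, v, x} = ⊤
  lift : ∀ (S : Type) [CommRing S] [Algebra ℂ S] (u' v' x' : S),
    u' * v' = Polynomial.aeval x' P → ∃ h : A →ₐ[ℂ] S, h u = u' ∧ h v = v' ∧ h x = x'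

namespace HS

variable {A : Type} [CommRing A] [Algebra ℂ A] {u v x : A} {P : Polynomial ℂ}

lemma symm (h : HS A u v x P) : HS A v u x P where
  rel := by rw [mul_comm, h.rel]
  ne := h.ne
  gen := by rw [← h.gen, Set.insert_comm]
  lift := by
    intro S _ _ u' v' x' hr
    obtain ⟨k, h1, h2, h3⟩ := h.lift S v' u' x' (by rw [mul_comm, hr])
    exact ⟨k, h2, h1, h3⟩

lemma hom_ext (h : HS A u v x P) {S : Type} [CommRing S] [Algebra ℂ S] (k l : A →ₐ[ℂ] S)
    (hu : k u = l u) (hv : k v = l v) (hx : k x = l x) : k = l := by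
  apply AlgHom.ext_of_adjoin_eq_top h.gen
  rintro y (rfl | rfl | rfl)
  · exact hu
  · exact hv
  · exact hx

lemma dvr (h : HS A u v x P) [IsDomain A] [IsNoetherianRing A] (p : ↥(heightOnePrimes A))
    (hp : u ∉ p.1.asIdeal) : IsDiscreteValuationRing (Localization.AtPrime p.1.asIdeal) := by
  let K := FractionRing (MvPolynomial (Fin 2) ℂ)
  let ι : (MvPolynomial (Fin 2) ℂ) →ₐ[ℂ] A := MvPolynomial.aeval ![u, x]
  have hu : ι (X 0) = u := by simp [ι]
  have hx : ι (X 1) = x := by simp [ι]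
  have hX0 : algebraMap (MvPolynomial (Fin 2) ℂ) K (X 0) ≠ 0 := by
    rw [Ne, IsFractionRing.to_map_eq_zero_iff]
    exact X_ne_zero 0
  obtain ⟨κ, k1, k2, k3⟩ := h.lift K (algebraMap (MvPolynomial (Fin 2) ℂ) K (X 0))
    ((algebraMap (MvPolynomial (Fin 2) ℂ) K (X 0))⁻¹ * Polynomial.aeval (algebraMap (MvPolynomial (Fin 2) ℂ) K (X 1)) P)
    (algebraMap (MvPolynomial (Fin 2) ℂ) K (X 1)) (by rw [← mul_assoc, mul_inv_cancel₀ hX0, one_mul])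
  have hκ : κ.comp ι = IsScalarTower.toAlgHom ℂ (MvPolynomial (Fin 2) ℂ) K := by
    apply MvPolynomial.algHom_ext
    intro i
    fin_cases i
    · change κ (ι (X 0)) = algebraMap (MvPolynomial (Fin 2) ℂ) K (X 0)
      rw [hu, k1]
    · change κ (ι (X 1)) = algebraMap (MvPolynomial (Fin 2) ℂ) K (X 1)
      rw [hx, k3]
  have hι : Function.Injective ι := by
    have h1 : Function.Injective (κ.comp ι) := by
      rw [hκ]
      exact IsFractionRing.injective (MvPolynomial (Fin 2) ℂ) K
    exact Function.Injective.of_comp h1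
  refine dvr_aux (ι : (MvPolynomial (Fin 2) ℂ) →+* A) hι (X 0) ?_ p (by simpa [hu] using hp)
  intro a
  have ha : a ∈ Algebra.adjoin ℂ {u, v, x} := by rw [h.gen]; trivial
  change ∃ (n : ℕ) (b : (MvPolynomial (Fin 2) ℂ)), ι (X 0) ^ n * a = ι b
  rw [hu]
  induction ha using Algebra.adjoin_induction with
  | mem y hy =>
    rcases hy with rfl | rfl | rfl
    · exact ⟨0, X 0, by simp [hu]⟩
    · refine ⟨1, Polynomial.aeval (X 1) P, ?_⟩
      rw [pow_one, h.rel, ← Polynomial.aeval_algHom_apply, hx]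
    · exact ⟨0, X 1, by simp [hx]⟩
  | algebraMap r => exact ⟨0, algebraMap ℂ (MvPolynomial (Fin 2) ℂ) r, by simp⟩
  | add y z _ _ hy hz =>
    obtain ⟨n, b, hb⟩ := hy
    obtain ⟨m, c, hc⟩ := hz
    refine ⟨n + m, X 0 ^ m * b + X 0 ^ n * c, ?_⟩
    simp only [map_add, map_mul, map_pow, hu, ← hb, ← hc]
    ring
  | mul y z _ _ hy hz =>
    obtain ⟨n, b, hb⟩ := hy
    obtain ⟨m, c, hc⟩ := hz
    refine ⟨n + m, b * c, ?_⟩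
    simp only [map_mul, ← hb, ← hc]
    ring

lemma not_both (h : HS A u v x P) [IsDomain A] (p : ↥(heightOnePrimes A))
    (hu : u ∈ p.1.asIdeal) (hv : v ∈ p.1.asIdeal) : False := by
  have hpp := p.1.isPrime
  have hP : Polynomial.aeval x P ∈ p.1.asIdeal := by
    rw [← h.rel]
    exact Ideal.mul_mem_right _ _ hu
  -- a root
  have hroot : ∃ γ : ℂ, P.eval γ = 0 ∧ x - algebraMap ℂ A γ ∈ p.1.asIdeal := by
    have hs := IsAlgClosed.splits P
    have he := hs.eq_prod_roots
    rw [he, map_mul, Polynomial.aeval_C] at hP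
    have hlc : algebraMap ℂ A P.leadingCoeff ∉ p.1.asIdeal := by
      intro hmem
      apply hpp.ne_top
      apply Ideal.eq_top_of_isUnit_mem _ hmem
      exact (isUnit_iff_ne_zero.mpr (Polynomial.leadingCoeff_ne_zero.mpr h.ne)).map _
    have hprod := (hpp.mem_or_mem hP).resolve_left hlc
    rw [map_multiset_prod, Multiset.map_map] at hprod
    rw [hpp.multiset_prod_mem_iff_exists_mem] at hprod
    obtain ⟨y, hy, hm⟩ := hprod
    obtain ⟨γ, hγ, rfl⟩ := Multiset.mem_map.mp hy
    refine ⟨γ, (Polynomial.mem_roots h.ne).mp hγ, ?_⟩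
    simpa using hm
  obtain ⟨γ, hγ, hxγ⟩ := hroot
  obtain ⟨k, k1, k2, k3⟩ := h.lift (Polynomial ℂ) 0 Polynomial.X (Polynomial.C γ) (by
    rw [zero_mul]
    have := Polynomial.aeval_algebraMap_apply (Polynomial ℂ) γ P
    rw [Polynomial.algebraMap_eq] at this
    rw [this]
    simp [hγ])
  have hfac : (Ideal.Quotient.mkₐ ℂ p.1.asIdeal) =
      (Polynomial.aeval (Ideal.Quotient.mk p.1.asIdeal v)).comp k := by
    apply h.hom_ext
    · rw [AlgHom.comp_apply, k1, map_zero]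
      exact Ideal.Quotient.eq_zero_iff_mem.mpr hu
    · rw [AlgHom.comp_apply, k2, Polynomial.aeval_X]; rfl
    · rw [AlgHom.comp_apply, k3, Polynomial.aeval_C]
      exact Ideal.Quotient.eq.mpr hxγ
  have hker : RingHom.ker k ≤ p.1.asIdeal := by
    intro y hy
    rw [RingHom.mem_ker] at hy
    have := DFunLike.congr_fun hfac y
    rw [AlgHom.comp_apply, hy, map_zero] at this
    exact Ideal.Quotient.eq_zero_iff_mem.mp this
  have hu0 : u ≠ 0 := by
    rintro rfl
    obtain ⟨l, l1, l2, l3⟩ := h.lift (Polynomial ℂ) 1 (Polynomial.aeval Polynomial.X P)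
      Polynomial.X (by simp)
    rw [map_zero] at l1
    exact zero_ne_one l1
  have hkp : (RingHom.ker k).IsPrime := RingHom.ker_isPrime _
  have hEq := height_one_eq p (RingHom.ker k) (by
    intro hb
    have : u ∈ RingHom.ker k := k1
    rw [hb, Ideal.mem_bot] at this
    exact hu0 this) hker
  rw [← hEq] at hv
  rw [RingHom.mem_ker, k2] at hv
  exact Polynomial.X_ne_zero hv

lemma dvr' (h : HS A u v x P) [IsDomain A] [IsNoetherianRing A] (p : ↥(heightOnePrimes A)) :
    IsDiscreteValuationRing (Localization.AtPrime p.1.asIdeal) := by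
  by_cases hu : u ∈ p.1.asIdeal
  · by_cases hv : v ∈ p.1.asIdeal
    · exact (h.not_both p hu hv).elim
    · exact h.symm.dvr p hv
  · exact h.dvr p hu

lemma kill_aux {A : Type} [CommRing A] [Algebra ℂ A] (k : A →ₐ[ℂ] Polynomial ℂ) (x0 : A)
    (hx0 : k x0 = Polynomial.X) (c : ℂ) (m : Ideal A)
    (hm : ∀ a, a ∈ m ↔ (k a).eval c = 0) : G0.mk (FGMod.of A (A ⧸ m)) = 0 := by
  have hsurj : Function.Surjective k := by
    intro g
    refine ⟨Polynomial.aeval x0 g, ?_⟩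
    rw [← Polynomial.aeval_algHom_apply, hx0, Polynomial.aeval_X_left_apply]
  let z : A := x0 - algebraMap ℂ A c
  have hz : k z = Polynomial.X - Polynomial.C c := by
    simp [z, hx0, Polynomial.algebraMap_eq]
  let I : Ideal A := RingHom.ker k
  have hI : ∀ a, a ∈ I ↔ k a = 0 := fun a => Iff.rfl
  have hle : I ≤ m := fun a ha => by rw [hm, (hI a).mp ha, Polynomial.eval_zero]
  let f : (A ⧸ I) →ₗ[A] (A ⧸ I) := z • LinearMap.id
  let g : (A ⧸ I) →ₗ[A] (A ⧸ m) := Submodule.factor hle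
  have hf' : ∀ a : A, f (Submodule.Quotient.mk a) = Submodule.Quotient.mk (z * a) := fun a => rfl
  have hg' : ∀ a : A, g (Submodule.Quotient.mk a) = Submodule.Quotient.mk a := fun a => rfl
  have hf : Function.Injective f := by
    rw [injective_iff_map_eq_zero]
    intro y hy
    obtain ⟨a, rfl⟩ := Submodule.mkQ_surjective _ y
    rw [Submodule.mkQ_apply] at hy ⊢
    rw [hf', Submodule.Quotient.mk_eq_zero, hI, map_mul, hz] at hy
    rw [Submodule.Quotient.mk_eq_zero, hI]
    exact (mul_eq_zero.mp hy).resolve_left (Polynomial.X_sub_C_ne_zero c)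
  have hg : Function.Surjective g := by
    intro y
    obtain ⟨a, rfl⟩ := Submodule.mkQ_surjective _ y
    exact ⟨Submodule.Quotient.mk a, rfl⟩
  have hex : Function.Exact f g := by
    intro y
    obtain ⟨a, rfl⟩ := Submodule.mkQ_surjective _ y
    rw [Submodule.mkQ_apply, hg', Submodule.Quotient.mk_eq_zero, hm]
    constructor
    · intro h0
      obtain ⟨q, hq⟩ := Polynomial.dvd_iff_isRoot.mpr h0
      obtain ⟨b, rfl⟩ := hsurj q
      refine ⟨Submodule.Quotient.mk b, ?_⟩
      rw [hf']
      refine (Submodule.Quotient.eq _).mpr ?_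
      rw [hI, map_sub, map_mul, hz, hq, sub_self]
    · rintro ⟨w, hw⟩
      obtain ⟨b, rfl⟩ := Submodule.mkQ_surjective _ w
      rw [Submodule.mkQ_apply, hf'] at hw
      have := (Submodule.Quotient.eq _).mp hw
      rw [hI, map_sub, map_mul, hz, sub_eq_zero] at this
      rw [← this]
      simp
  have := G0.mk_exact (A ⧸ I) (A ⧸ I) (A ⧸ m) f g hf hg hex
  exact left_eq_add.mp this

lemma kill_unit (h : HS A u v x P) (m : Ideal A) (ev : A →ₐ[ℂ] ℂ) (hm : ∀ a, a ∈ m ↔ ev a = 0)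
    (hu : ev u ≠ 0) : G0.mk (FGMod.of A (A ⧸ m)) = 0 := by
  obtain ⟨k, k1, k2, k3⟩ := h.lift (Polynomial ℂ) (Polynomial.C (ev u))
    (Polynomial.C (ev u)⁻¹ * P) Polynomial.X (by
      rw [← mul_assoc, ← Polynomial.C_mul, mul_inv_cancel₀ hu]
      simp)
  refine kill_aux k x k3 (ev x) m fun a => ?_
  rw [hm]
  have : ev = (Polynomial.aeval (ev x)).comp k := by
    apply h.hom_ext
    · simp [k1]
    · have hr := congrArg ev h.rel
      rw [map_mul, ← Polynomial.aeval_algHom_apply] at hr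
      rw [AlgHom.comp_apply, k2, map_mul, ← hr, Polynomial.aeval_C]
      simp only [Algebra.algebraMap_self, RingHom.id_apply]
      field_simp
    · simp [k3]
  conv_lhs => rw [this]
  rw [AlgHom.comp_apply, Polynomial.coe_aeval_eq_eval]

lemma kill (h : HS A u v x P) (m : Ideal A) (ev : A →ₐ[ℂ] ℂ) (hm : ∀ a, a ∈ m ↔ ev a = 0) :
    G0.mk (FGMod.of A (A ⧸ m)) = 0 := by
  by_cases hu : ev u = 0
  · by_cases hv : ev v = 0
    · have hr := congrArg ev h.rel
      rw [map_mul, ← Polynomial.aeval_algHom_apply, hu, zero_mul] at hr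
      obtain ⟨k, k1, k2, k3⟩ := h.lift (Polynomial ℂ) Polynomial.X 0 (Polynomial.C (ev x)) (by
        rw [mul_zero]
        have := Polynomial.aeval_algebraMap_apply (Polynomial ℂ) (ev x) P
        rw [Polynomial.algebraMap_eq] at this
        rw [this, ← hr, map_zero])
      refine kill_aux k u k1 0 m fun a => ?_
      rw [hm]
      have : ev = (Polynomial.aeval (0 : ℂ)).comp k := by
        apply h.hom_ext
        · simp [k1, hu]
        · simp [k2, hv]
        · simp [k3]
      conv_lhs => rw [this]
      rw [AlgHom.comp_apply, Polynomial.coe_aeval_eq_eval]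
    · exact h.symm.kill_unit m ev hm hv
  · exact h.kill_unit m ev hm hu

end HS


section Hyper

variable (t : ℕ) (f : Fin t → MvPolynomial (Fin 1) ℂ) (a : Fin t → ℕ)

/-- The product of the `fᵢ ^ aᵢ` in `ℂ[x]`. -/
noncomputable def hyperF : MvPolynomial (Fin 1) ℂ := ∏ i, f i ^ a i

/-- The product of the `fᵢ ^ aᵢ` as a univariate polynomial. -/
noncomputable def hyperP : Polynomial ℂ :=
  MvPolynomial.aeval (fun _ : Fin 1 => (Polynomial.X : Polynomial ℂ)) (hyperF t f a)

/-- The defining equation. -/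
noncomputable def hyperEq : MvPolynomial (Fin 2 ⊕ Fin 1) ℂ :=
  X (Sum.inl 0) * X (Sum.inl 1) - rename Sum.inr (hyperF t f a)

lemma hyperIdeal_eq : hyperIdeal 1 t f a = Ideal.span {hyperEq t f a} := by
  simp only [hyperIdeal, hyperEq, hyperF, map_prod, map_pow]

lemma aeval_hyperP {S : Type} [CommRing S] [Algebra ℂ S] (s : S) :
    Polynomial.aeval s (hyperP t f a) = MvPolynomial.aeval (fun _ : Fin 1 => s) (hyperF t f a) := by
  have : (Polynomial.aeval s).comp
      (MvPolynomial.aeval (fun _ : Fin 1 => (Polynomial.X : Polynomial ℂ))) =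
      MvPolynomial.aeval (fun _ : Fin 1 => s) := by
    apply MvPolynomial.algHom_ext
    intro i
    simp
  exact DFunLike.congr_fun this (hyperF t f a)

lemma hyperF_ne (hirr : ∀ i, Irreducible (f i)) : hyperF t f a ≠ 0 :=
  Finset.prod_ne_zero_iff.mpr fun i _ => pow_ne_zero _ (hirr i).ne_zero

lemma hyperP_ne (hirr : ∀ i, Irreducible (f i)) : hyperP t f a ≠ 0 := by
  intro h0
  apply hyperF_ne t f a hirr
  have h1 := aeval_hyperP t f a (X 0 : MvPolynomial (Fin 1) ℂ)
  rw [h0, map_zero] at h1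
  have h2 : (fun _ : Fin 1 => (X 0 : MvPolynomial (Fin 1) ℂ)) = X := by
    funext i
    rw [Subsingleton.elim i 0]
  rw [h2, MvPolynomial.aeval_X_left_apply] at h1
  exact h1.symm

lemma hyper_HS (hirr : ∀ i, Irreducible (f i)) :
    HS (HyperRing 1 t f a) (Ideal.Quotient.mk (hyperIdeal 1 t f a) (X (Sum.inl 0)))
      (Ideal.Quotient.mk (hyperIdeal 1 t f a) (X (Sum.inl 1)))
      (Ideal.Quotient.mk (hyperIdeal 1 t f a) (X (Sum.inr 0))) (hyperP t f a) where
  rel := by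
    rw [aeval_hyperP]
    have h1 : (Ideal.Quotient.mk (hyperIdeal 1 t f a)) (rename Sum.inr (hyperF t f a)) =
        MvPolynomial.aeval (fun _ : Fin 1 =>
          (Ideal.Quotient.mk (hyperIdeal 1 t f a) (X (Sum.inr 0)))) (hyperF t f a) := by
      have : ((Ideal.Quotient.mkₐ ℂ (hyperIdeal 1 t f a)).comp (rename Sum.inr)) =
          MvPolynomial.aeval (fun _ : Fin 1 =>
          (Ideal.Quotient.mk (hyperIdeal 1 t f a) (X (Sum.inr 0)))) := by
        apply MvPolynomial.algHom_ext
        intro i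
        rw [Subsingleton.elim i 0]
        simp
      exact DFunLike.congr_fun this (hyperF t f a)
    rw [← h1, ← map_mul]
    refine Ideal.Quotient.eq.mpr ?_
    rw [hyperIdeal_eq]
    exact Ideal.mem_span_singleton_self _
  ne := hyperP_ne t f a hirr
  gen := by
    have h1 := congrArg (Subalgebra.map (Ideal.Quotient.mkₐ ℂ (hyperIdeal 1 t f a)))
      (MvPolynomial.adjoin_range_X (R := ℂ) (σ := Fin 2 ⊕ Fin 1))
    rw [Algebra.map_top, AlgHom.map_adjoin,
      (AlgHom.range_eq_top _).mpr (Ideal.Quotient.mkₐ_surjective ℂ (hyperIdeal 1 t f a))] at h1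
    rw [← top_le_iff, ← h1]
    apply Algebra.adjoin_mono
    rintro _ ⟨_, ⟨i, rfl⟩, rfl⟩
    rcases i with i | i
    · fin_cases i
      · exact Or.inl rfl
      · exact Or.inr (Or.inl rfl)
    · rw [Subsingleton.elim i 0]
      exact Or.inr (Or.inr rfl)
  lift := by
    intro S _ _ u' v' x' hr
    let g : MvPolynomial (Fin 2 ⊕ Fin 1) ℂ →ₐ[ℂ] S :=
      MvPolynomial.aeval (Sum.elim ![u', v'] (fun _ => x'))
    have hg : ∀ y ∈ hyperIdeal 1 t f a, g y = 0 := by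
      intro y hy
      rw [hyperIdeal_eq, Ideal.mem_span_singleton] at hy
      obtain ⟨c, rfl⟩ := hy
      have : g (hyperEq t f a) = 0 := by
        rw [aeval_hyperP] at hr
        simp only [g, hyperEq, map_sub, map_mul, MvPolynomial.aeval_X, MvPolynomial.aeval_rename,
          Sum.elim_inl, Matrix.cons_val_zero, Matrix.cons_val_one, hr]
        exact sub_self _
      rw [map_mul, this, zero_mul]
    refine ⟨Ideal.Quotient.liftₐ _ g hg, ?_, ?_, ?_⟩
    · change g (X _) = _
      simp [g]
    · change g (X _) = _
      simp [g]
    · change g (X _) = _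
      simp [g]

lemma not_X_dvd (hirr : ∀ i, Irreducible (f i)) :
    ¬ (X (Sum.inl 0) : MvPolynomial (Fin 2 ⊕ Fin 1) ℂ) ∣ rename Sum.inr (hyperF t f a) := by
  rintro ⟨c, hc⟩
  apply hyperF_ne t f a hirr
  have := congrArg (MvPolynomial.aeval
    (Sum.elim (fun _ => 0) X : Fin 2 ⊕ Fin 1 → MvPolynomial (Fin 1) ℂ)) hc
  rw [MvPolynomial.aeval_rename, map_mul, MvPolynomial.aeval_X, Sum.elim_inl, zero_mul,
    Sum.elim_comp_inr, MvPolynomial.aeval_X_left_apply] at this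
  exact this

lemma hyperEq_irreducible (hirr : ∀ i, Irreducible (f i)) : Irreducible (hyperEq t f a) := by
  classical
  rw [hyperEq, sub_eq_add_neg]
  have hX : Prime (X (Sum.inl 0) : MvPolynomial (Fin 2 ⊕ Fin 1) ℂ) := MvPolynomial.X_prime
  apply MvPolynomial.irreducible_mul_X_add
  · exact MvPolynomial.X_ne_zero _
  · simp
  · rw [MvPolynomial.vars_neg]
    intro h
    have := MvPolynomial.vars_rename _ _ h
    simp at this
  · rw [IsRelPrime.neg_right_iff]
    exact (hX.irreducible.isRelPrime_iff_not_dvd).mpr (not_X_dvd t f a hirr)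

lemma hyper_isDomain (hirr : ∀ i, Irreducible (f i)) : IsDomain (HyperRing 1 t f a) := by
  have : (hyperIdeal 1 t f a).IsPrime := by
    rw [hyperIdeal_eq, Ideal.span_singleton_prime (hyperEq_irreducible t f a hirr).ne_zero]
    exact (hyperEq_irreducible t f a hirr).prime
  exact Ideal.Quotient.isDomain _

lemma hyper_dim (hirr : ∀ i, Irreducible (f i)) : ringKrullDim (HyperRing 1 t f a) ≤ 2 := by
  have h1 := ringKrullDim_quotient_succ_le_of_nonZeroDivisor
    (mem_nonZeroDivisors_of_ne_zero (hyperEq_irreducible t f a hirr).ne_zero)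
  rw [← hyperIdeal_eq, MvPolynomial.ringKrullDim_of_isNoetherianRing,
    ringKrullDim_eq_zero_of_field] at h1
  have h2 : (0 : WithBot ℕ∞) + (Nat.card (Fin 2 ⊕ Fin 1) : WithBot ℕ∞) = 2 + 1 := by
    simp [Nat.card_eq_fintype_card]
    rfl
  have h3 : ringKrullDim (HyperRing 1 t f a) + 1 ≤ 2 + 1 := h1.trans h2.le
  revert h3
  generalize ringKrullDim (HyperRing 1 t f a) = d
  intro h3
  induction d with
  | bot => exact bot_le
  | coe d =>
    have h4 : d + 1 ≤ 2 + 1 := WithBot.coe_le_coe.mp h3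
    have h5 : d ≤ 2 := (ENat.add_le_add_iff_right (by simp)).mp h4
    exact WithBot.coe_le_coe.mpr h5

lemma hyper_maximal (hirr : ∀ i, Irreducible (f i)) [IsDomain (HyperRing 1 t f a)]
    (q : PrimeSpectrum (HyperRing 1 t f a)) (hq : q ≠ ⊥) (hq1 : Order.height q ≠ 1) :
    q.asIdeal.IsMaximal := by
  obtain ⟨M, hM, hle⟩ := Ideal.exists_le_maximal q.asIdeal q.isPrime.ne_top
  by_cases hEq : q.asIdeal = M
  · rwa [hEq]
  exfalso
  let m : PrimeSpectrum (HyperRing 1 t f a) := ⟨M, hM.isPrime⟩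
  have hlt : q < m := lt_of_le_of_ne hle fun h => hEq (congrArg PrimeSpectrum.asIdeal h)
  have h0 : (⊥ : PrimeSpectrum (HyperRing 1 t f a)) < q := bot_lt_iff_ne_bot.mpr hq
  have h1 := Order.height_add_one_le h0
  rw [Order.height_bot, zero_add] at h1
  have h2 : 2 ≤ Order.height q := by
    have := Order.add_one_le_of_lt (lt_of_le_of_ne h1 (Ne.symm hq1))
    rwa [one_add_one_eq_two] at this
  have h3 : 2 + 1 ≤ Order.height m :=
    (add_le_add_left h2 1).trans (Order.height_add_one_le hlt)
  have h4 : (Order.height m : WithBot ℕ∞) ≤ 2 :=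
    (Order.height_le_krullDim m).trans (hyper_dim t f a hirr)
  have h5 : Order.height m ≤ 2 := WithBot.coe_le_coe.mp h4
  have h6 := h3.trans h5
  exact absurd h6 (by decide)

lemma hyper_point (m : Ideal (HyperRing 1 t f a)) [m.IsMaximal] :
    ∃ ev : HyperRing 1 t f a →ₐ[ℂ] ℂ, ∀ y, y ∈ m ↔ ev y = 0 := by
  have hmax : (m.comap (Ideal.Quotient.mk (hyperIdeal 1 t f a))).IsMaximal :=
    Ideal.comap_isMaximal_of_surjective _ Ideal.Quotient.mk_surjective
  obtain ⟨pt, hpt⟩ := (MvPolynomial.isMaximal_iff_eq_vanishingIdeal_singleton (K := ℂ)).mp hmax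
  have hmem : ∀ y, Ideal.Quotient.mk (hyperIdeal 1 t f a) y ∈ m ↔
      MvPolynomial.aeval pt y = 0 := by
    intro y
    rw [← Ideal.mem_comap, hpt, MvPolynomial.mem_vanishingIdeal_singleton_iff]
  refine ⟨Ideal.Quotient.liftₐ _ (MvPolynomial.aeval pt) ?_, ?_⟩
  · intro y hy
    rw [← hmem, Ideal.Quotient.eq_zero_iff_mem.mpr hy]
    exact Ideal.zero_mem _
  · intro y
    obtain ⟨y, rfl⟩ := Ideal.Quotient.mk_surjective y
    exact hmem y

end Hyper

end ConcretePart

/-- **`G₀(A) ≅ ℤ ⊕ Cl(A)` for `2`-dimensional hypersurfaces.**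
Let `A` be the `2`-dimensional ring `ℂ[u,v,x]/(uv - f₁^{a₁} ⋯ f_t^{a_t})` with the
`fᵢ ∈ ℂ[x]` irreducible pairwise coprime and `aᵢ ≥ 1`.  Then
`G₀(A) ≅ ℤ ⊕ Cl(A)`, where the `ℤ`-summand is given by the rank map (so that the free
module `[A]` of rank one corresponds to `(1, 0)`). -/
theorem g0_iso_int_prod_classGroup_dim_two (t : ℕ) (f : Fin t → MvPolynomial (Fin 1) ℂ)
    (hirr : ∀ i, Irreducible (f i)) (hcop : ∀ i j, i ≠ j → IsRelPrime (f i) (f j))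
    (a : Fin t → ℕ) (ha : ∀ i, 1 ≤ a i) :
    ∃ e : G0 (HyperRing 1 t f a) ≃+ ℤ × ClassGrp (HyperRing 1 t f a),
      e (G0.mk (FGMod.of (HyperRing 1 t f a) (HyperRing 1 t f a))) = (1, 0) := by
  haveI := hyper_isDomain t f a hirr
  refine g0_general ?_ fun p => (hyper_HS t f a hirr).dvr' p
  intro q hq hq1
  haveI := hyper_maximal t f a hirr q hq hq1
  obtain ⟨ev, hev⟩ := hyper_point t f a q.asIdeal
  exact (hyper_HS t f a hirr).kill q.asIdeal ev hev
end
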